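/- arXiv:2303.01474 — 2 statements merged into one kernel-verified Lean document; each statement's English description precedes it below -/
import Mathlib

section
/- Let X ⊆ ℝⁿ be closed and let (x̄,ȳ) be a local solution of the minimax problem min_{x∈X} max_{y∈F(x)} f(x,y) in the sense of Stackelberg. Suppose the solution map S is inner semicontinuous at (x̄,ȳ), the local error bound holds for the system g(x,y) ≤ 0 at (x̄,ȳ), and {Σ_i λ_i ∇_x g_i(x̄,ȳ) : λ ∈ Σ⁰(x̄,ȳ)} = {0}. Then there exists λ̄ ∈ ℝ^q such that 0 ∈ ∇_x L(x̄,ȳ,λ̄) + N_X(x̄), ∇_y L(x̄,ȳ,λ̄) = 0, λ̄ ≥ 0, g(x̄,ȳ) ≤ 0, and λ̄ᵀg(x̄,ȳ) = 0. -/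
open Filter Topology Metric RealInnerProductSpace

noncomputable section

/-- Feasible region of the parametric maximization problem. -/
def Feas {n m q : ℕ} (g : EuclideanSpace ℝ (Fin n) → EuclideanSpace ℝ (Fin m) → Fin q → ℝ)
    (x : EuclideanSpace ℝ (Fin n)) : Set (EuclideanSpace ℝ (Fin m)) :=
  {y | ∀ i, g x y i ≤ 0}

/-- Maximal value function (EReal valued; `sSup ∅ = ⊥ = -∞`). -/
def Vfun {n m q : ℕ} (f : EuclideanSpace ℝ (Fin n) → EuclideanSpace ℝ (Fin m) → ℝ)
    (g : EuclideanSpace ℝ (Fin n) → EuclideanSpace ℝ (Fin m) → Fin q → ℝ)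
    (x : EuclideanSpace ℝ (Fin n)) : EReal :=
  sSup ((fun y => (f x y : EReal)) '' Feas g x)

/-- Solution map of the parametric maximization problem. -/
def Sol {n m q : ℕ} (f : EuclideanSpace ℝ (Fin n) → EuclideanSpace ℝ (Fin m) → ℝ)
    (g : EuclideanSpace ℝ (Fin n) → EuclideanSpace ℝ (Fin m) → Fin q → ℝ)
    (x : EuclideanSpace ℝ (Fin n)) : Set (EuclideanSpace ℝ (Fin m)) :=
  {y ∈ Feas g x | (f x y : EReal) = Vfun f g x}

/-- Lagrangian `L(x,y,λ) = f(x,y) - λᵀ g(x,y)`. -/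
def Lag {n m q : ℕ} (f : EuclideanSpace ℝ (Fin n) → EuclideanSpace ℝ (Fin m) → ℝ)
    (g : EuclideanSpace ℝ (Fin n) → EuclideanSpace ℝ (Fin m) → Fin q → ℝ)
    (x : EuclideanSpace ℝ (Fin n)) (y : EuclideanSpace ℝ (Fin m)) (lam : Fin q → ℝ) : ℝ :=
  f x y - ∑ i, lam i * g x y i

/-- Partial gradient in `x`. -/
def gradx {n m : ℕ} (φ : EuclideanSpace ℝ (Fin n) → EuclideanSpace ℝ (Fin m) → ℝ)
    (x : EuclideanSpace ℝ (Fin n)) (y : EuclideanSpace ℝ (Fin m)) : EuclideanSpace ℝ (Fin n) :=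
  gradient (fun x' => φ x' y) x

/-- Partial gradient in `y`. -/
def grady {n m : ℕ} (φ : EuclideanSpace ℝ (Fin n) → EuclideanSpace ℝ (Fin m) → ℝ)
    (x : EuclideanSpace ℝ (Fin n)) (y : EuclideanSpace ℝ (Fin m)) : EuclideanSpace ℝ (Fin m) :=
  gradient (fun y' => φ x y') y

/-- `∇_y L(x,y,λ)`. -/
def gradyL {n m q : ℕ} (f : EuclideanSpace ℝ (Fin n) → EuclideanSpace ℝ (Fin m) → ℝ)
    (g : EuclideanSpace ℝ (Fin n) → EuclideanSpace ℝ (Fin m) → Fin q → ℝ)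
    (x : EuclideanSpace ℝ (Fin n)) (y : EuclideanSpace ℝ (Fin m)) (lam : Fin q → ℝ) :
    EuclideanSpace ℝ (Fin m) :=
  grady (fun x y => Lag f g x y lam) x y

/-- `∇_x L(x,y,λ)`. -/
def gradxL {n m q : ℕ} (f : EuclideanSpace ℝ (Fin n) → EuclideanSpace ℝ (Fin m) → ℝ)
    (g : EuclideanSpace ℝ (Fin n) → EuclideanSpace ℝ (Fin m) → Fin q → ℝ)
    (x : EuclideanSpace ℝ (Fin n)) (y : EuclideanSpace ℝ (Fin m)) (lam : Fin q → ℝ) :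
    EuclideanSpace ℝ (Fin n) :=
  gradx (fun x y => Lag f g x y lam) x y

/-- `∇_y g(x,y)ᵀ u ∈ ℝ^q`. -/
def gyTu {n m q : ℕ} (g : EuclideanSpace ℝ (Fin n) → EuclideanSpace ℝ (Fin m) → Fin q → ℝ)
    (x : EuclideanSpace ℝ (Fin n)) (y : EuclideanSpace ℝ (Fin m)) (u : EuclideanSpace ℝ (Fin m)) :
    Fin q → ℝ :=
  fun i => ⟪grady (fun x y => g x y i) x y, u⟫

/-- `∇²_{yy} L(x,y,λ) u`. -/
def hessyyLu {n m q : ℕ} (f : EuclideanSpace ℝ (Fin n) → EuclideanSpace ℝ (Fin m) → ℝ)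
    (g : EuclideanSpace ℝ (Fin n) → EuclideanSpace ℝ (Fin m) → Fin q → ℝ)
    (x : EuclideanSpace ℝ (Fin n)) (y : EuclideanSpace ℝ (Fin m)) (lam : Fin q → ℝ)
    (u : EuclideanSpace ℝ (Fin m)) : EuclideanSpace ℝ (Fin m) :=
  gradient (fun y' => ⟪gradyL f g x y' lam, u⟫) y

/-- `∇²_{xy} L(x,y,λ) u ∈ ℝⁿ` (for `u ∈ ℝᵐ`). -/
def hessxyLu {n m q : ℕ} (f : EuclideanSpace ℝ (Fin n) → EuclideanSpace ℝ (Fin m) → ℝ)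
    (g : EuclideanSpace ℝ (Fin n) → EuclideanSpace ℝ (Fin m) → Fin q → ℝ)
    (x : EuclideanSpace ℝ (Fin n)) (y : EuclideanSpace ℝ (Fin m)) (lam : Fin q → ℝ)
    (u : EuclideanSpace ℝ (Fin m)) : EuclideanSpace ℝ (Fin n) :=
  gradient (fun x' => ⟪gradyL f g x' y lam, u⟫) x

/-- Multiplier set `Σ(x,y)`. -/
def SigmaSet {n m q : ℕ} (f : EuclideanSpace ℝ (Fin n) → EuclideanSpace ℝ (Fin m) → ℝ)
    (g : EuclideanSpace ℝ (Fin n) → EuclideanSpace ℝ (Fin m) → Fin q → ℝ)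
    (x : EuclideanSpace ℝ (Fin n)) (y : EuclideanSpace ℝ (Fin m)) : Set (Fin q → ℝ) :=
  {lam | gradyL f g x y lam = 0 ∧ (∀ i, 0 ≤ lam i) ∧ (∀ i, g x y i ≤ 0) ∧
    ∑ i, lam i * g x y i = 0}

/-- Singular multiplier set `Σ⁰(x,y)`. -/
def SigmaZero {n m q : ℕ} (g : EuclideanSpace ℝ (Fin n) → EuclideanSpace ℝ (Fin m) → Fin q → ℝ)
    (x : EuclideanSpace ℝ (Fin n)) (y : EuclideanSpace ℝ (Fin m)) : Set (Fin q → ℝ) :=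
  {lam | ∑ i, lam i • grady (fun x y => g x y i) x y = 0 ∧ (∀ i, 0 ≤ lam i) ∧
    (∀ i, g x y i ≤ 0) ∧ ∑ i, lam i * g x y i = 0}

/-- The set `Ξ^r(x,y,λ)`. -/
def XiSet {n m q : ℕ} (r : ℝ) (f : EuclideanSpace ℝ (Fin n) → EuclideanSpace ℝ (Fin m) → ℝ)
    (g : EuclideanSpace ℝ (Fin n) → EuclideanSpace ℝ (Fin m) → Fin q → ℝ)
    (x : EuclideanSpace ℝ (Fin n)) (y : EuclideanSpace ℝ (Fin m)) (lam : Fin q → ℝ) :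
    Set (EuclideanSpace ℝ (Fin m)) :=
  {u | hessyyLu f g x y lam u = 0 ∧ (∀ i, 0 ≤ -(gyTu g x y u i) - r * g x y i) ∧
    (∀ i, 0 ≤ lam i) ∧ ∑ i, lam i * (-(gyTu g x y u i) - r * g x y i) = 0}

/-- Fréchet (regular) subdifferential of an `EReal` valued function. -/
def FSub {n : ℕ} (φ : EuclideanSpace ℝ (Fin n) → EReal) (x₀ : EuclideanSpace ℝ (Fin n)) :
    Set (EuclideanSpace ℝ (Fin n)) :=
  {v | ∃ c : ℝ, φ x₀ = (c : EReal) ∧ ∀ ε : ℝ, 0 < ε → ∃ δ : ℝ, 0 < δ ∧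
    ∀ x, ‖x - x₀‖ < δ → ((c + ⟪v, x - x₀⟫ - ε * ‖x - x₀‖ : ℝ) : EReal) ≤ φ x}

/-- Limiting (Mordukhovich) subdifferential. -/
def LSub {n : ℕ} (φ : EuclideanSpace ℝ (Fin n) → EReal) (x₀ : EuclideanSpace ℝ (Fin n)) :
    Set (EuclideanSpace ℝ (Fin n)) :=
  {v | ∃ (xk : ℕ → EuclideanSpace ℝ (Fin n)) (vk : ℕ → EuclideanSpace ℝ (Fin n)),
    (∀ k, vk k ∈ FSub φ (xk k)) ∧ Tendsto xk atTop (𝓝 x₀) ∧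
    Tendsto (fun k => φ (xk k)) atTop (𝓝 (φ x₀)) ∧ Tendsto vk atTop (𝓝 v)}

/-- Horizon (singular) subdifferential. -/
def HorSub {n : ℕ} (φ : EuclideanSpace ℝ (Fin n) → EReal) (x₀ : EuclideanSpace ℝ (Fin n)) :
    Set (EuclideanSpace ℝ (Fin n)) :=
  {v | ∃ (xk : ℕ → EuclideanSpace ℝ (Fin n)) (vk : ℕ → EuclideanSpace ℝ (Fin n)) (tk : ℕ → ℝ),
    (∀ k, vk k ∈ FSub φ (xk k)) ∧ (∀ k, 0 < tk k) ∧ Tendsto tk atTop (𝓝 0) ∧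
    Tendsto xk atTop (𝓝 x₀) ∧ Tendsto (fun k => φ (xk k)) atTop (𝓝 (φ x₀)) ∧
    Tendsto (fun k => tk k • vk k) atTop (𝓝 v)}

/-- Clarke subdifferential (for locally Lipschitz functions): convex hull of the limiting one. -/
def CSub {n : ℕ} (φ : EuclideanSpace ℝ (Fin n) → EReal) (x₀ : EuclideanSpace ℝ (Fin n)) :
    Set (EuclideanSpace ℝ (Fin n)) :=
  convexHull ℝ (LSub φ x₀)

/-- `φ` is (finite-valued and) Lipschitz continuous near `x₀`. -/
def LipschitzNearAt {n : ℕ} (φ : EuclideanSpace ℝ (Fin n) → EReal)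
    (x₀ : EuclideanSpace ℝ (Fin n)) : Prop :=
  ∃ δ : ℝ, 0 < δ ∧ ∃ K : NNReal, ∃ ψ : EuclideanSpace ℝ (Fin n) → ℝ,
    LipschitzWith K ψ ∧ ∀ x ∈ ball x₀ δ, φ x = (ψ x : EReal)

/-- Regular (Fréchet) normal cone. -/
def regNC {n : ℕ} (C : Set (EuclideanSpace ℝ (Fin n))) (x₀ : EuclideanSpace ℝ (Fin n)) :
    Set (EuclideanSpace ℝ (Fin n)) :=
  {ξ | ∀ ε : ℝ, 0 < ε → ∃ δ : ℝ, 0 < δ ∧ ∀ x ∈ C, ‖x - x₀‖ < δ →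
    ⟪ξ, x - x₀⟫ ≤ ε * ‖x - x₀‖}

/-- Limiting (Mordukhovich) normal cone. -/
def limNC {n : ℕ} (C : Set (EuclideanSpace ℝ (Fin n))) (x₀ : EuclideanSpace ℝ (Fin n)) :
    Set (EuclideanSpace ℝ (Fin n)) :=
  {ξ | ∃ (xk : ℕ → EuclideanSpace ℝ (Fin n)) (ξk : ℕ → EuclideanSpace ℝ (Fin n)),
    (∀ k, xk k ∈ C) ∧ (∀ k, ξk k ∈ regNC C (xk k)) ∧
    Tendsto xk atTop (𝓝 x₀) ∧ Tendsto ξk atTop (𝓝 ξ)}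

/-- Inner semicontinuity of the solution map at `(x̄, ȳ)`. -/
def InnerSemicont {n m q : ℕ} (f : EuclideanSpace ℝ (Fin n) → EuclideanSpace ℝ (Fin m) → ℝ)
    (g : EuclideanSpace ℝ (Fin n) → EuclideanSpace ℝ (Fin m) → Fin q → ℝ)
    (xb : EuclideanSpace ℝ (Fin n)) (yb : EuclideanSpace ℝ (Fin m)) : Prop :=
  ∀ xk : ℕ → EuclideanSpace ℝ (Fin n), Tendsto xk atTop (𝓝 xb) →
    ∃ yk : ℕ → EuclideanSpace ℝ (Fin m), (∀ k, yk k ∈ Sol f g (xk k)) ∧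
      Tendsto yk atTop (𝓝 yb)

/-- Local error bound for the system `g(x,y) ≤ 0` at `(x̄, ȳ)`. -/
def LocalErrorBound {n m q : ℕ}
    (g : EuclideanSpace ℝ (Fin n) → EuclideanSpace ℝ (Fin m) → Fin q → ℝ)
    (xb : EuclideanSpace ℝ (Fin n)) (yb : EuclideanSpace ℝ (Fin m)) : Prop :=
  ∃ κ δ : ℝ, 0 < κ ∧ 0 < δ ∧
    ∀ x y, ‖((x, y) : EuclideanSpace ℝ (Fin n) × EuclideanSpace ℝ (Fin m)) - (xb, yb)‖ < δ →
      Metric.infDist ((x, y) : EuclideanSpace ℝ (Fin n) × EuclideanSpace ℝ (Fin m))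
          {p : EuclideanSpace ℝ (Fin n) × EuclideanSpace ℝ (Fin m) | ∀ i, g p.1 p.2 i ≤ 0}
        ≤ κ * ∑ i, max (g x y i) 0

/-- MFCQ for the system `g(x̄, ·) ≤ 0` at `ȳ`. -/
def MFCQy {n m q : ℕ} (g : EuclideanSpace ℝ (Fin n) → EuclideanSpace ℝ (Fin m) → Fin q → ℝ)
    (xb : EuclideanSpace ℝ (Fin n)) (yb : EuclideanSpace ℝ (Fin m)) : Prop :=
  ∀ lam : Fin q → ℝ, (∀ i, 0 ≤ lam i) → (∑ i, lam i * g xb yb i = 0) →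
    (∀ i, g xb yb i ≤ 0) → (∑ i, lam i • grady (fun x y => g x y i) xb yb = 0) → lam = 0

/-- Restricted sup-compactness at `x̄`. -/
def RestrictedSupCompact {n m q : ℕ}
    (f : EuclideanSpace ℝ (Fin n) → EuclideanSpace ℝ (Fin m) → ℝ)
    (g : EuclideanSpace ℝ (Fin n) → EuclideanSpace ℝ (Fin m) → Fin q → ℝ)
    (xb : EuclideanSpace ℝ (Fin n)) : Prop :=
  (∃ c : ℝ, Vfun f g xb = (c : EReal)) ∧
  ∃ ε δ : ℝ, 0 < ε ∧ 0 < δ ∧ ∃ Ω : Set (EuclideanSpace ℝ (Fin m)), IsCompact Ω ∧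
    ∀ x, ‖x - xb‖ < δ → Vfun f g xb - (ε : EReal) < Vfun f g x → (Sol f g x ∩ Ω).Nonempty

/-- Robinson stability of the feasible map at `(x̄, ȳ)`. -/
def RobinsonStability {n m q : ℕ}
    (g : EuclideanSpace ℝ (Fin n) → EuclideanSpace ℝ (Fin m) → Fin q → ℝ)
    (xb : EuclideanSpace ℝ (Fin n)) (yb : EuclideanSpace ℝ (Fin m)) : Prop :=
  ∃ κ δ : ℝ, 0 < κ ∧ 0 < δ ∧
    ∀ x y, ‖((x, y) : EuclideanSpace ℝ (Fin n) × EuclideanSpace ℝ (Fin m)) - (xb, yb)‖ < δ →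
      Metric.infDist y (Feas g x) ≤ κ * ∑ i, max (g x y i) 0

/-- A constraint qualification holds at the feasible point `w₀` of the system
`{w : G w ≤ 0, H w = 0}`: local minimizers of C¹ functions over the feasible set
satisfy the KKT conditions. -/
def CQAt {W : Type} [NormedAddCommGroup W] [NormedSpace ℝ W] {p p' : ℕ}
    (G : W → Fin p → ℝ) (H : W → Fin p' → ℝ) (w₀ : W) : Prop :=
  ∀ θ : W → ℝ, ContDiff ℝ 1 θ →
    IsLocalMinOn θ {w | (∀ i, G w i ≤ 0) ∧ ∀ j, H w j = 0} w₀ →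
    ∃ (lam : Fin p → ℝ) (mu : Fin p' → ℝ), (∀ i, 0 ≤ lam i) ∧
      (fderiv ℝ θ w₀ + ∑ i, lam i • fderiv ℝ (fun w => G w i) w₀ +
        ∑ j, mu j • fderiv ℝ (fun w => H w j) w₀ = 0) ∧
      ∑ i, lam i * G w₀ i = 0

/-- Inequality constraints of the Wolfe dual system (`λ ≥ 0`). -/
def WolfeG (n m q : ℕ) :
    (EuclideanSpace ℝ (Fin n) × EuclideanSpace ℝ (Fin m) × (Fin q → ℝ)) → Fin q → ℝ :=
  fun w i => -(w.2.2 i)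

/-- Equality constraints of the Wolfe dual system (`∇_y L(x,y,λ) = 0`). -/
def WolfeH {n m q : ℕ} (f : EuclideanSpace ℝ (Fin n) → EuclideanSpace ℝ (Fin m) → ℝ)
    (g : EuclideanSpace ℝ (Fin n) → EuclideanSpace ℝ (Fin m) → Fin q → ℝ) :
    (EuclideanSpace ℝ (Fin n) × EuclideanSpace ℝ (Fin m) × (Fin q → ℝ)) → Fin m → ℝ :=
  fun w j => gradyL f g w.1 w.2.1 w.2.2 j

/-- The multiplier set `M(β, x, y)` of the parametric program. -/
def MultSetP {n m q : ℕ} (g : EuclideanSpace ℝ (Fin n) → EuclideanSpace ℝ (Fin m) → Fin q → ℝ)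
    (β : EuclideanSpace ℝ (Fin m)) (x : EuclideanSpace ℝ (Fin n))
    (y : EuclideanSpace ℝ (Fin m)) : Set (Fin q → ℝ) :=
  {lam | β - ∑ i, lam i • grady (fun x y => g x y i) x y = 0 ∧ (∀ i, 0 ≤ lam i) ∧
    ∑ i, lam i * g x y i = 0 ∧ ∀ i, g x y i ≤ 0}

/-- A stable parametric CQ holds at `ȳ ∈ F(x̄)` for the parametric system `g(x,·) ≤ 0`. -/
def StableParamCQ {n m q : ℕ} (f : EuclideanSpace ℝ (Fin n) → EuclideanSpace ℝ (Fin m) → ℝ)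
    (g : EuclideanSpace ℝ (Fin n) → EuclideanSpace ℝ (Fin m) → Fin q → ℝ)
    (xb : EuclideanSpace ℝ (Fin n)) (yb : EuclideanSpace ℝ (Fin m)) : Prop :=
  ∃ P : EuclideanSpace ℝ (Fin n) → EuclideanSpace ℝ (Fin m) → Prop,
    (∃ δ : ℝ, 0 < δ ∧ ∀ x y, y ∈ Feas g x → ‖x - xb‖ < δ → ‖y - yb‖ < δ → P x y) ∧
    (∀ x y, P x y → y ∈ Feas g x → IsLocalMaxOn (f x) (Feas g x) y →
      (MultSetP g (grady f x y) x y).Nonempty) ∧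
    (∀ (βk : ℕ → EuclideanSpace ℝ (Fin m)) (xk : ℕ → EuclideanSpace ℝ (Fin n))
        (yk : ℕ → EuclideanSpace ℝ (Fin m)) (βb : EuclideanSpace ℝ (Fin m)),
      Tendsto βk atTop (𝓝 βb) → Tendsto xk atTop (𝓝 xb) → Tendsto yk atTop (𝓝 yb) →
      (∀ k, (MultSetP g (βk k) (xk k) (yk k)).Nonempty) →
      ∃ (lamk : ℕ → Fin q → ℝ) (φ : ℕ → ℕ) (lamb : Fin q → ℝ),
        StrictMono φ ∧ (∀ k, lamk k ∈ MultSetP g (βk k) (xk k) (yk k)) ∧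
        Tendsto (lamk ∘ φ) atTop (𝓝 lamb) ∧ lamb ∈ MultSetP g βb xb yb)

/-- The multiplier set `M(β, w)` of a (nonparametric) system `{w : G w ≤ 0, H w = 0}`. -/
def MultSetW {W : Type} [NormedAddCommGroup W] [NormedSpace ℝ W] {p p' : ℕ}
    (G : W → Fin p → ℝ) (H : W → Fin p' → ℝ) (β : W →L[ℝ] ℝ) (w : W) :
    Set ((Fin p → ℝ) × (Fin p' → ℝ)) :=
  {lm | (∀ i, 0 ≤ lm.1 i) ∧
    (β - ∑ i, lm.1 i • fderiv ℝ (fun w => G w i) w -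
      ∑ j, lm.2 j • fderiv ℝ (fun w => H w j) w = 0) ∧
    ∑ i, lm.1 i * G w i = 0}

/-- A stable CQ holds at the feasible point `w̄` of the system `{w : G w ≤ 0, H w = 0}`. -/
def StableCQ {W : Type} [NormedAddCommGroup W] [NormedSpace ℝ W] {p p' : ℕ}
    (G : W → Fin p → ℝ) (H : W → Fin p' → ℝ) (wb : W) : Prop :=
  ∃ P : W → Prop,
    (P wb ∧ ∃ δ : ℝ, 0 < δ ∧ ∀ w, (∀ i, G w i ≤ 0) → (∀ j, H w j = 0) → ‖w - wb‖ < δ → P w) ∧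
    (∀ w, P w → (∀ i, G w i ≤ 0) → (∀ j, H w j = 0) →
      ∀ θ : W → ℝ, ContDiff ℝ 1 θ →
        IsLocalMinOn θ {w' | (∀ i, G w' i ≤ 0) ∧ ∀ j, H w' j = 0} w →
        ∃ (lam : Fin p → ℝ) (mu : Fin p' → ℝ), (∀ i, 0 ≤ lam i) ∧
          (fderiv ℝ θ w + ∑ i, lam i • fderiv ℝ (fun w => G w i) w +
            ∑ j, mu j • fderiv ℝ (fun w => H w j) w = 0) ∧
          ∑ i, lam i * G w i = 0) ∧
    (∀ (βk : ℕ → W →L[ℝ] ℝ) (wk : ℕ → W) (βb : W →L[ℝ] ℝ),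
      Tendsto βk atTop (𝓝 βb) → Tendsto wk atTop (𝓝 wb) →
      (∀ k, (∀ i, G (wk k) i ≤ 0) ∧ ∀ j, H (wk k) j = 0) →
      (∀ k, (MultSetW G H (βk k) (wk k)).Nonempty) →
      ∃ (lmk : ℕ → (Fin p → ℝ) × (Fin p' → ℝ)) (φ : ℕ → ℕ) (lmb : (Fin p → ℝ) × (Fin p' → ℝ)),
        StrictMono φ ∧ (∀ k, lmk k ∈ MultSetW G H (βk k) (wk k)) ∧
        Tendsto (lmk ∘ φ) atTop (𝓝 lmb) ∧ lmb ∈ MultSetW G H βb wb)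

/-- Critical cone of `(P_x̄)` at `y` associated with the multiplier `λ`. -/
def CritCone {n m q : ℕ} (g : EuclideanSpace ℝ (Fin n) → EuclideanSpace ℝ (Fin m) → Fin q → ℝ)
    (xb : EuclideanSpace ℝ (Fin n)) (y : EuclideanSpace ℝ (Fin m)) (lam : Fin q → ℝ) :
    Set (EuclideanSpace ℝ (Fin m)) :=
  {d | ∀ i, g xb y i = 0 →
    (0 < lam i → ⟪grady (fun x y => g x y i) xb y, d⟫ = 0) ∧
    (lam i = 0 → ⟪grady (fun x y => g x y i) xb y, d⟫ ≤ 0)}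

/-- Second order sufficient condition at `(y, λ)` for `(P_x̄)`. -/
def SOSC {n m q : ℕ} (f : EuclideanSpace ℝ (Fin n) → EuclideanSpace ℝ (Fin m) → ℝ)
    (g : EuclideanSpace ℝ (Fin n) → EuclideanSpace ℝ (Fin m) → Fin q → ℝ)
    (xb : EuclideanSpace ℝ (Fin n)) (y : EuclideanSpace ℝ (Fin m)) (lam : Fin q → ℝ) : Prop :=
  ∀ d ∈ CritCone g xb y lam, d ≠ 0 → ⟪d, hessyyLu f g xb y lam d⟫ < 0

/-- `(x̄, ȳ)` is a local solution of the minimax problem in the sense of Stackelberg. -/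
def StackelbergLocal {n m q : ℕ} (f : EuclideanSpace ℝ (Fin n) → EuclideanSpace ℝ (Fin m) → ℝ)
    (g : EuclideanSpace ℝ (Fin n) → EuclideanSpace ℝ (Fin m) → Fin q → ℝ)
    (X : Set (EuclideanSpace ℝ (Fin n))) (xb : EuclideanSpace ℝ (Fin n))
    (yb : EuclideanSpace ℝ (Fin m)) : Prop :=
  xb ∈ X ∧ yb ∈ Sol f g xb ∧ IsLocalMinOn (Vfun f g) X xb

/-- Feasible region of the MPEC reformulation `(P_MPEC)`. -/
def MPECFeas {n m q : ℕ} (f : EuclideanSpace ℝ (Fin n) → EuclideanSpace ℝ (Fin m) → ℝ)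
    (g : EuclideanSpace ℝ (Fin n) → EuclideanSpace ℝ (Fin m) → Fin q → ℝ)
    (X : Set (EuclideanSpace ℝ (Fin n))) :
    Set (EuclideanSpace ℝ (Fin n) × EuclideanSpace ℝ (Fin m) × (Fin q → ℝ)) :=
  {w | w.1 ∈ X ∧ gradyL f g w.1 w.2.1 w.2.2 = 0 ∧ (∀ i, g w.1 w.2.1 i ≤ 0) ∧
    (∀ i, 0 ≤ w.2.2 i) ∧ ∑ i, w.2.2 i * g w.1 w.2.1 i = 0}

/-- S-stationarity for `(P_MPEC)`. -/
def SStationary {n m q : ℕ} (f : EuclideanSpace ℝ (Fin n) → EuclideanSpace ℝ (Fin m) → ℝ)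
    (g : EuclideanSpace ℝ (Fin n) → EuclideanSpace ℝ (Fin m) → Fin q → ℝ)
    (X : Set (EuclideanSpace ℝ (Fin n))) (xb : EuclideanSpace ℝ (Fin n))
    (yb : EuclideanSpace ℝ (Fin m)) (lamb : Fin q → ℝ) : Prop :=
  ∃ (u : EuclideanSpace ℝ (Fin m)) (α β : Fin q → ℝ),
    -(gradx f xb yb + ∑ i, α i • gradx (fun x y => g x y i) xb yb +
        hessxyLu f g xb yb lamb u) ∈ limNC X xb ∧
    grady f xb yb + ∑ i, α i • grady (fun x y => g x y i) xb yb +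
      hessyyLu f g xb yb lamb u = 0 ∧
    (∀ i, -(gyTu g xb yb u i) - β i = 0) ∧
    (∀ i, g xb yb i < 0 → lamb i = 0 → α i = 0) ∧
    (∀ i, g xb yb i = 0 → 0 < lamb i → β i = 0) ∧
    (∀ i, g xb yb i = 0 → lamb i = 0 → 0 ≤ α i ∧ 0 ≤ β i)


/-- Optimal value function of the Wolfe dual (`sInf ∅ = ⊤`). -/
def VD {n m q : ℕ} (f : EuclideanSpace ℝ (Fin n) → EuclideanSpace ℝ (Fin m) → ℝ)
    (g : EuclideanSpace ℝ (Fin n) → EuclideanSpace ℝ (Fin m) → Fin q → ℝ)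
    (x : EuclideanSpace ℝ (Fin n)) : EReal :=
  sInf ((fun p : EuclideanSpace ℝ (Fin m) × (Fin q → ℝ) => (Lag f g x p.1 p.2 : EReal)) ''
    {p | gradyL f g x p.1 p.2 = 0 ∧ ∀ i, 0 ≤ p.2 i})

/-- Strict differentiability of an `EReal`-valued function at `x₀` with gradient `ζ`. -/
def StrictDiffAt {n : ℕ} (φ : EuclideanSpace ℝ (Fin n) → EReal)
    (x₀ ζ : EuclideanSpace ℝ (Fin n)) : Prop :=
  ∀ ε : ℝ, 0 < ε → ∃ δ : ℝ, 0 < δ ∧ ∀ x x', ‖x - x₀‖ < δ → ‖x' - x₀‖ < δ →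
    ∃ a b : ℝ, φ x = (a : EReal) ∧ φ x' = (b : EReal) ∧
      |a - b - ⟪ζ, x - x'⟫| ≤ ε * ‖x - x'‖

/-- `f` and `g` are separable with respect to `x` and `y`. -/
def SeparableFG {n m q : ℕ} (f : EuclideanSpace ℝ (Fin n) → EuclideanSpace ℝ (Fin m) → ℝ)
    (g : EuclideanSpace ℝ (Fin n) → EuclideanSpace ℝ (Fin m) → Fin q → ℝ) : Prop :=
  ∃ (f₁ : EuclideanSpace ℝ (Fin n) → ℝ) (f₂ : EuclideanSpace ℝ (Fin m) → ℝ)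
    (g₁ : EuclideanSpace ℝ (Fin n) → Fin q → ℝ) (g₂ : EuclideanSpace ℝ (Fin m) → Fin q → ℝ),
    (∀ x y, f x y = f₁ x + f₂ y) ∧ ∀ x y i, g x y i = g₁ x i + g₂ y i

end

/-- A functional dominated by `d ↦ c * ∑ i, max (a i d) 0` is a combination of the `a i` with
coefficients in `[0, c]`. -/
theorem exists_multiplier_of_le_sum_max {P : Type*} [NormedAddCommGroup P] [NormedSpace ℝ P]
    [FiniteDimensional ℝ P] {ι : Type*} [Fintype ι] (ξ : P →L[ℝ] ℝ) (a : ι → P →L[ℝ] ℝ)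
    {c : ℝ} (hc : 0 ≤ c) (h : ∀ d, ξ d ≤ c * ∑ i, max (a i d) 0) :
    ∃ lam : ι → ℝ, (∀ i, 0 ≤ lam i ∧ lam i ≤ c) ∧ ξ = ∑ i, lam i • a i := by
  let T : (ι → ℝ) →ₗ[ℝ] (P →L[ℝ] ℝ) := Fintype.linearCombination ℝ a
  have hT : ∀ lam, T lam = ∑ i, lam i • a i := fun lam => Fintype.linearCombination_apply ℝ a lam
  have hcomp : IsCompact (T '' Set.Icc (0 : ι → ℝ) (fun _ => c)) :=
    isCompact_Icc.image T.continuous_of_finiteDimensional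
  by_cases hmem : ξ ∈ T '' Set.Icc (0 : ι → ℝ) (fun _ => c)
  · obtain ⟨lam, hlam, rfl⟩ := hmem
    exact ⟨lam, fun i => ⟨hlam.1 i, hlam.2 i⟩, hT lam⟩
  exfalso
  obtain ⟨Φ, u, h1, h2⟩ := geometric_hahn_banach_closed_point
    ((convex_Icc (0 : ι → ℝ) (fun _ => c)).linear_image T) hcomp.isClosed hmem
  let e : (P →ₗ[ℝ] ℝ) ≃ₗ[ℝ] (P →L[ℝ] ℝ) := LinearMap.toContinuousLinearMap
  obtain ⟨d, hd⟩ := (Module.evalEquiv ℝ P).surjective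
    ((Φ : (P →L[ℝ] ℝ) →ₗ[ℝ] ℝ) ∘ₗ (e : (P →ₗ[ℝ] ℝ) →ₗ[ℝ] (P →L[ℝ] ℝ)))
  have hΦ : ∀ ζ : P →L[ℝ] ℝ, Φ ζ = ζ d := by
    intro ζ
    have h1 := congrArg (fun L => L (e.symm ζ)) hd
    have h2 : Φ (e (e.symm ζ)) = e (e.symm ζ) d := h1.symm
    rwa [e.apply_symm_apply] at h2
  let lam : ι → ℝ := fun i => if 0 ≤ a i d then c else 0
  have hlam : lam ∈ Set.Icc (0 : ι → ℝ) (fun _ => c) := by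
    constructor <;> intro i <;> by_cases hi : 0 ≤ a i d <;> simp [lam, hi, hc]
  have h3 := h1 _ ⟨lam, hlam, rfl⟩
  rw [hΦ, hT] at h3
  rw [hΦ] at h2
  have h4 : (∑ i, lam i • a i) d = c * ∑ i, max (a i d) 0 := by
    rw [_root_.sum_apply, Finset.mul_sum]
    refine Finset.sum_congr rfl fun i _ => ?_
    by_cases hi : 0 ≤ a i d
    · simp [lam, hi]
    · simp [lam, hi, max_eq_right (not_le.1 hi).le]
  linarith [h d]

/-- Under a local error bound, regular normals to `{p | ∀ i, G i p ≤ 0}` are dominated by the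
linearized active constraints. -/
theorem regular_normal_le_of_error_bound {P : Type*} [NormedAddCommGroup P] [NormedSpace ℝ P]
    {ι : Type*} [Fintype ι] {G : ι → P → ℝ} {a : ι → P →L[ℝ] ℝ} {p : P} {κ : ℝ}
    (hp : ∀ i, G i p ≤ 0) (hG : ∀ i, HasFDerivAt (G i) (a i) p)
    (heb : ∀ᶠ z in 𝓝 p, infDist z {z | ∀ i, G i z ≤ 0} ≤ κ * ∑ i, max (G i z) 0)
    {ξ : P →L[ℝ] ℝ}
    (hξ : ∀ ε > 0, ∀ᶠ z in 𝓝 p, (∀ i, G i z ≤ 0) → ξ (z - p) ≤ ε * ‖z - p‖) (d : P) :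
    ξ d ≤ κ * ‖ξ‖ * ∑ i, max ((if G i p = 0 then a i else 0) d) 0 := by
  set S : ℝ := ∑ i, max ((if G i p = 0 then a i else 0) d) 0
  have hline : Tendsto (fun t : ℝ => p + t • d) (𝓝[>] 0) (𝓝 p) := by
    have : Continuous fun t : ℝ => p + t • d := by fun_prop
    have := this.tendsto 0
    simp only [zero_smul, add_zero] at this
    exact this.mono_left nhdsWithin_le_nhds
  have hR : Tendsto (fun t : ℝ => (κ * ∑ i, max (G i (p + t • d)) 0) / t) (𝓝[>] 0)
      (𝓝 (κ * S)) := by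
    have hi : ∀ i, Tendsto (fun t : ℝ => max (G i (p + t • d)) 0 / t) (𝓝[>] 0)
        (𝓝 (max ((if G i p = 0 then a i else 0) d) 0)) := by
      intro i
      by_cases h0 : G i p = 0
      · have hd : HasDerivAt (fun t : ℝ => G i (p + t • d)) (a i d) 0 := by
          have h1 : HasDerivAt (fun t : ℝ => p + t • d) d 0 := by
            simpa using ((hasDerivAt_id (0 : ℝ)).smul_const d).const_add p
          have h2 : HasFDerivAt (G i) (a i) (p + (0 : ℝ) • d) := by simpa using hG i
          exact h2.comp_hasDerivAt (0 : ℝ) h1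
        have := hd.tendsto_slope_zero_right
        simp only [zero_add, zero_smul, add_zero, h0, sub_zero, smul_eq_mul] at this
        simp only [h0, if_true]
        refine (this.max (tendsto_const_nhds (x := (0 : ℝ)))).congr' ?_
        filter_upwards [self_mem_nhdsWithin] with t ht
        have ht : 0 < t := ht
        rw [div_eq_inv_mul, mul_max_of_nonneg _ _ (inv_pos.2 ht).le, mul_zero]
      · have hneg : G i p < 0 := lt_of_le_of_ne (hp i) h0
        simp only [h0, if_false, _root_.zero_apply, max_self]
        refine tendsto_const_nhds.congr' ?_
        filter_upwards [hline.eventually ((hG i).continuousAt.eventually_lt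
          continuousAt_const hneg)] with t ht
        rw [max_eq_right ht.le, zero_div]
    have := (tendsto_finsetSum Finset.univ fun i _ => hi i).const_mul κ
    refine this.congr fun t => ?_
    rw [mul_div_assoc, Finset.sum_div]
  have key : ∀ ε > 0, ξ d ≤ ε * (‖d‖ + (κ * S + ε)) + ‖ξ‖ * (κ * S + ε) := by
    intro ε hε
    have hlim : Tendsto (fun t : ℝ => ε * (‖d‖ + ((κ * ∑ i, max (G i (p + t • d)) 0) / t + ε))
        + ‖ξ‖ * ((κ * ∑ i, max (G i (p + t • d)) 0) / t + ε)) (𝓝[>] 0)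
        (𝓝 (ε * (‖d‖ + (κ * S + ε)) + ‖ξ‖ * (κ * S + ε))) :=
      (((hR.add_const ε).const_add ‖d‖).const_mul ε).add ((hR.add_const ε).const_mul ‖ξ‖)
    refine ge_of_tendsto hlim ?_
    obtain ⟨r, hr, hball⟩ := Metric.eventually_nhds_iff.1 (hξ ε hε)
    have hsmall : Tendsto (fun t : ℝ => t * (‖d‖ + ((κ * ∑ i, max (G i (p + t • d)) 0) / t + ε)))
        (𝓝[>] 0) (𝓝 (0 * (‖d‖ + (κ * S + ε)))) :=
      (tendsto_id.mono_left nhdsWithin_le_nhds).mul ((hR.add_const ε).const_add ‖d‖)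
    rw [zero_mul] at hsmall
    filter_upwards [hline.eventually heb, self_mem_nhdsWithin,
      hsmall.eventually (gt_mem_nhds hr)] with t ht1 ht0 ht2
    have ht0 : 0 < t := ht0
    set R := κ * ∑ i, max (G i (p + t • d)) 0
    have hne : ({z | ∀ i, G i z ≤ 0} : Set P).Nonempty := ⟨p, hp⟩
    obtain ⟨z, hz, hdz⟩ := (infDist_lt_iff hne).1
      (lt_of_le_of_lt ht1 (lt_add_of_pos_right R (mul_pos ht0 hε)))
    rw [dist_eq_norm] at hdz
    have hRt : R + t * ε = t * (R / t + ε) := by field_simp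
    have hnorm : ‖z - p‖ ≤ t * (‖d‖ + (R / t + ε)) := by
      have h1 : z - p = t • d - (p + t • d - z) := by abel
      calc ‖z - p‖ ≤ ‖t • d‖ + ‖p + t • d - z‖ := by rw [h1]; exact norm_sub_le _ _
        _ ≤ t * ‖d‖ + (R + t * ε) := by
          rw [norm_smul, Real.norm_of_nonneg ht0.le]; linarith
        _ = _ := by rw [hRt]; ring
    have h2 : ξ (z - p) ≤ ε * ‖z - p‖ := hball (by rw [dist_eq_norm]; linarith) hz
    have h3 : ξ (t • d) = ξ (z - p) + ξ (p + t • d - z) := by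
      rw [← map_add]; congr 1; abel
    have h4 : ξ (p + t • d - z) ≤ ‖ξ‖ * (R + t * ε) :=
      (le_abs_self _).trans ((ξ.le_opNorm _).trans
        (mul_le_mul_of_nonneg_left hdz.le (norm_nonneg _)))
    have h5 : t * ξ d ≤ t * (ε * (‖d‖ + (R / t + ε)) + ‖ξ‖ * (R / t + ε)) := by
      calc t * ξ d = ξ (t • d) := by simp
        _ ≤ ε * (t * (‖d‖ + (R / t + ε))) + ‖ξ‖ * (t * (R / t + ε)) := by
          rw [h3, ← hRt]
          exact add_le_add (h2.trans (mul_le_mul_of_nonneg_left hnorm hε.le)) h4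
        _ = _ := by ring
    exact le_of_mul_le_mul_left h5 ht0
  have hlim : Tendsto (fun ε : ℝ => ε * (‖d‖ + (κ * S + ε)) + ‖ξ‖ * (κ * S + ε)) (𝓝[>] 0)
      (𝓝 (κ * ‖ξ‖ * S)) := by
    have : Continuous fun ε : ℝ => ε * (‖d‖ + (κ * S + ε)) + ‖ξ‖ * (κ * S + ε) := by fun_prop
    have := (this.tendsto 0).mono_left (nhdsWithin_le_nhds (s := Set.Ioi 0))
    convert this using 2
    ring
  exact ge_of_tendsto hlim (by filter_upwards [self_mem_nhdsWithin] with ε hε using key ε hε)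

/-- `v` is a regular (Fréchet) supergradient of `φ` at `x`. -/
def IsRegularSupergradient {E : Type*} [NormedAddCommGroup E] [NormedSpace ℝ E]
    (φ : E → ℝ) (v : E →L[ℝ] ℝ) (x : E) : Prop :=
  ∀ ε > 0, ∀ᶠ z in 𝓝 x, φ z ≤ φ x + v (z - x) + ε * ‖z - x‖

theorem HasFDerivAt.isRegularSupergradient {E : Type*} [NormedAddCommGroup E] [NormedSpace ℝ E]
    {φ : E → ℝ} {v : E →L[ℝ] ℝ} {x : E} (h : HasFDerivAt φ v x) :
    IsRegularSupergradient φ v x := by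
  intro ε hε
  filter_upwards [(hasFDerivAt_iff_isLittleO.1 h).def hε] with z hz
  have := (le_abs_self _).trans hz
  linarith

/-- Multipliers for a regular supergradient `v` of a function `φ` that dominates `F₀` over the
feasible set and agrees with it at the feasible point `p`. -/
theorem IsRegularSupergradient.exists_multiplier {E F : Type*} [NormedAddCommGroup E]
    [NormedSpace ℝ E] [FiniteDimensional ℝ E] [NormedAddCommGroup F] [NormedSpace ℝ F]
    [FiniteDimensional ℝ F] {ι : Type*} [Fintype ι] {F₀ : E × F → ℝ} {G : ι → E × F → ℝ}
    {φ : E → ℝ} {κ : ℝ} (hκ : 0 ≤ κ) {p : E × F}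
    (hF₀ : DifferentiableAt ℝ F₀ p) (hG : ∀ i, DifferentiableAt ℝ (G i) p)
    (heb : ∀ᶠ z in 𝓝 p, infDist z {z | ∀ i, G i z ≤ 0} ≤ κ * ∑ i, max (G i z) 0)
    (hp : ∀ i, G i p ≤ 0) (hφp : φ p.1 = F₀ p)
    (hφ : ∀ᶠ z in 𝓝 p, (∀ i, G i z ≤ 0) → F₀ z ≤ φ z.1)
    {v : E →L[ℝ] ℝ} (hv : IsRegularSupergradient φ v p.1) :
    ∃ lam : ι → ℝ, (∀ i, 0 ≤ lam i ∧
        lam i ≤ κ * ‖fderiv ℝ F₀ p - v.comp (ContinuousLinearMap.fst ℝ E F)‖) ∧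
      (∀ i, G i p ≠ 0 → lam i = 0) ∧
      fderiv ℝ F₀ p - v.comp (ContinuousLinearMap.fst ℝ E F) = ∑ i, lam i • fderiv ℝ (G i) p := by
  set ξ := fderiv ℝ F₀ p - v.comp (ContinuousLinearMap.fst ℝ E F) with hξdef
  have hξ : ∀ ε > 0, ∀ᶠ z in 𝓝 p, (∀ i, G i z ≤ 0) → ξ (z - p) ≤ ε * ‖z - p‖ := by
    intro ε hε
    filter_upwards [hφ, continuousAt_fst.eventually (hv (ε / 2) (half_pos hε)),
      (hasFDerivAt_iff_isLittleO.1 hF₀.hasFDerivAt).def (half_pos hε)] with z h1 h2 h3 hz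
    have h4 := (neg_le_abs _).trans h3
    have h5 : ‖z.1 - p.1‖ ≤ ‖z - p‖ := norm_fst_le (z - p)
    have h6 : ξ (z - p) = fderiv ℝ F₀ p (z - p) - v (z.1 - p.1) := by simp [hξdef]
    have := h1 hz
    have := mul_le_mul_of_nonneg_left h5 (half_pos hε).le
    rw [h6]
    linarith
  obtain ⟨lam, h1, h2⟩ := exists_multiplier_of_le_sum_max ξ
    (fun i => if G i p = 0 then fderiv ℝ (G i) p else 0) (mul_nonneg hκ (norm_nonneg ξ))
    (fun d => regular_normal_le_of_error_bound hp (fun i => (hG i).hasFDerivAt) heb hξ d)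
  refine ⟨fun i => if G i p = 0 then lam i else 0, fun i => ?_, fun i hi => if_neg hi, ?_⟩
  · by_cases hi : G i p = 0
    · simpa [hi] using h1 i
    · simpa [hi] using mul_nonneg hκ (norm_nonneg ξ)
  · rw [h2]
    refine Finset.sum_congr rfl fun i _ => ?_
    by_cases hi : G i p = 0 <;> simp [hi]
open MeasureTheory in
/-- Averaging a Lipschitz function over small balls gives a uniformly close differentiable
function whose derivative lies in the closed convex hull of the nearby derivatives. -/
theorem LipschitzWith.exists_differentiable_approx {E : Type*} [NormedAddCommGroup E]
    [NormedSpace ℝ E] [FiniteDimensional ℝ E] {K : NNReal} {ψ : E → ℝ} (hψ : LipschitzWith K ψ)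
    {ε : ℝ} (hε : 0 < ε) :
    ∃ Ψ : E → ℝ, (∀ x, |Ψ x - ψ x| ≤ K * ε) ∧ Differentiable ℝ Ψ ∧
      ∀ (x : E) (A : Set (E →L[ℝ] ℝ)), IsClosed A → Convex ℝ A →
        (∀ z, ‖z - x‖ < ε → DifferentiableAt ℝ ψ z → fderiv ℝ ψ z ∈ A) → fderiv ℝ Ψ x ∈ A := by
  borelize E
  let vol : Measure E := Measure.addHaar
  let μ : Measure E := ProbabilityTheory.cond vol (ball 0 ε)
  have : IsProbabilityMeasure μ := ProbabilityTheory.cond_isProbabilityMeasure_of_finite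
    (measure_ball_pos vol 0 hε).ne' measure_ball_lt_top.ne
  have hμball : ∀ᵐ w ∂μ, w ∈ ball (0 : E) ε := ProbabilityTheory.ae_cond_mem measurableSet_ball
  have hψint : ∀ x, Integrable (fun w => ψ (x + w)) μ := by
    intro x
    refine Integrable.of_bound (C := |ψ x| + K * ε)
      (hψ.continuous.comp (continuous_const.add continuous_id)).aestronglyMeasurable ?_
    filter_upwards [hμball] with w hw
    have h1 := hψ.dist_le_mul (x + w) x
    rw [Real.dist_eq, dist_eq_norm, add_sub_cancel_left] at h1
    rw [mem_ball_zero_iff] at hw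
    have h2 : |ψ (x + w)| ≤ |ψ x| + |ψ (x + w) - ψ x| := by
      have := abs_add_le (ψ x) (ψ (x + w) - ψ x)
      rwa [add_sub_cancel] at this
    have h3 : (K : ℝ) * ‖w‖ ≤ K * ε := mul_le_mul_of_nonneg_left hw.le K.2
    rw [Real.norm_eq_abs]
    linarith
  have hdiffae : ∀ x, ∀ᵐ w ∂μ, DifferentiableAt ℝ ψ (x + w) := by
    intro x
    have h1 : ∀ᵐ w ∂vol, DifferentiableAt ℝ ψ (x + w) :=
      (measurePreserving_add_left vol x).quasiMeasurePreserving.ae hψ.ae_differentiableAt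
    exact ProbabilityTheory.cond_absolutelyContinuous.ae_le h1
  have hderiv : ∀ x, Integrable (fun w => fderiv ℝ ψ (x + w)) μ ∧
      HasFDerivAt (fun x => ∫ w, ψ (x + w) ∂μ) (∫ w, fderiv ℝ ψ (x + w) ∂μ) x := by
    intro x
    refine hasFDerivAt_integral_of_dominated_loc_of_lip (bound := fun _ => (K : ℝ)) univ_mem
      (Eventually.of_forall fun y => (hψint y).aestronglyMeasurable) (hψint x) ?_ ?_
      (integrable_const _) ?_
    · exact ((measurable_fderiv ℝ ψ).comp (measurable_const_add x)).aestronglyMeasurable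
    · refine Eventually.of_forall fun w => ?_
      rw [lipschitzOnWith_univ]
      refine LipschitzWith.of_dist_le_mul fun y z => ?_
      have := hψ.dist_le_mul (y + w) (z + w)
      rw [dist_add_right] at this
      simpa using this
    · filter_upwards [hdiffae x] with w hw
      have := hw.hasFDerivAt.comp x ((hasFDerivAt_id x).add_const w)
      simpa [Function.comp_def] using this
  refine ⟨fun x => ∫ w, ψ (x + w) ∂μ, fun x => ?_, fun x => (hderiv x).2.differentiableAt,
    fun x A hA hAc h => ?_⟩
  · have h1 : (∫ w, ψ (x + w) ∂μ) - ψ x = ∫ w, (ψ (x + w) - ψ x) ∂μ := by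
      rw [integral_sub (hψint x) (integrable_const _)]; simp
    rw [h1, ← Real.norm_eq_abs]
    refine (norm_integral_le_of_norm_le_const (C := K * ε) ?_).trans (by simp)
    filter_upwards [hμball] with w hw
    have h1 := hψ.dist_le_mul (x + w) x
    rw [Real.dist_eq, dist_eq_norm, add_sub_cancel_left] at h1
    rw [mem_ball_zero_iff] at hw
    exact h1.trans (mul_le_mul_of_nonneg_left hw.le K.2)
  · rw [(hderiv x).2.fderiv]
    refine hAc.integral_mem hA ?_ (hderiv x).1
    filter_upwards [hμball, hdiffae x] with w hw hd
    rw [mem_ball_zero_iff] at hw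
    exact h _ (by simpa using hw) hd
/-- `φ` is, near `xb`, the value function of maximizing `F₀ (x, ·)` over `{y | ∀ i, G i (x, y) ≤ 0}`,
with maximizers that can be chosen arbitrarily close to `yb`. -/
structure IsLocalValueFunction {E F ι : Type*} [TopologicalSpace E] [TopologicalSpace F]
    (F₀ : E × F → ℝ) (G : ι → E × F → ℝ) (φ : E → ℝ) (pb : E × F) : Prop where
  le : ∀ᶠ x in 𝓝 pb.1, ∀ y, (∀ i, G i (x, y) ≤ 0) → F₀ (x, y) ≤ φ x
  attained : ∀ U ∈ 𝓝 pb.2, ∀ᶠ x in 𝓝 pb.1, ∃ y ∈ U, (∀ i, G i (x, y) ≤ 0) ∧ φ x = F₀ (x, y)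

theorem IsLocalValueFunction.attained_prod {E F ι : Type*} [TopologicalSpace E]
    [TopologicalSpace F] {F₀ : E × F → ℝ} {G : ι → E × F → ℝ} {φ : E → ℝ} {pb : E × F}
    (h : IsLocalValueFunction F₀ G φ pb) {O : Set (E × F)} (hO : O ∈ 𝓝 pb) :
    ∀ᶠ x in 𝓝 pb.1, ∃ y, (x, y) ∈ O ∧ (∀ i, G i (x, y) ≤ 0) ∧ φ x = F₀ (x, y) := by
  rw [nhds_prod_eq] at hO
  obtain ⟨U, hU, W, hW, hUW⟩ := mem_prod_iff.1 hO
  filter_upwards [hU, h.attained W hW] with x hx hy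
  obtain ⟨y, hyW, hy⟩ := hy
  exact ⟨y, hUW ⟨hx, hyW⟩, hy⟩

theorem IsLocalValueFunction.eventually_exists_multiplier {E F : Type*} [NormedAddCommGroup E]
    [NormedSpace ℝ E] [FiniteDimensional ℝ E] [NormedAddCommGroup F] [NormedSpace ℝ F]
    [FiniteDimensional ℝ F] {ι : Type*} [Fintype ι] {F₀ : E × F → ℝ} {G : ι → E × F → ℝ}
    {φ : E → ℝ} {pb : E × F} (h : IsLocalValueFunction F₀ G φ pb)
    (hF₀ : Differentiable ℝ F₀) (hG : ∀ i, Differentiable ℝ (G i)) {κ : ℝ} (hκ : 0 ≤ κ)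
    (heb : ∀ᶠ z in 𝓝 pb, infDist z {z | ∀ i, G i z ≤ 0} ≤ κ * ∑ i, max (G i z) 0)
    {O : Set (E × F)} (hO : O ∈ 𝓝 pb) :
    ∀ᶠ x in 𝓝 pb.1, ∀ v, IsRegularSupergradient φ v x → ∃ p ∈ O, p.1 = x ∧ ∃ lam : ι → ℝ,
      (∀ i, 0 ≤ lam i ∧
        lam i ≤ κ * ‖fderiv ℝ F₀ p - v.comp (ContinuousLinearMap.fst ℝ E F)‖) ∧
      (∀ i, G i p ≠ 0 → lam i = 0) ∧
      fderiv ℝ F₀ p - v.comp (ContinuousLinearMap.fst ℝ E F) =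
        ∑ i, lam i • fderiv ℝ (G i) p := by
  filter_upwards [h.attained_prod (inter_mem hO heb.eventually_nhds),
    h.le.eventually_nhds] with x hx hle v hv
  obtain ⟨y, ⟨hyO, hyeb⟩, hyG, hyφ⟩ := hx
  refine ⟨(x, y), hyO, rfl, hv.exists_multiplier hκ (hF₀ _) (fun i => hG i _) hyeb hyG hyφ ?_⟩
  exact (continuousAt_fst (p := (x, y))).eventually hle |>.mono fun z hz hzG => hz z.2 hzG

/-- If singular multipliers contribute nothing in the `x` direction, regular supergradients of
the value function are bounded near the reference point. -/
theorem IsLocalValueFunction.exists_bound_supergradient {E F : Type*} [NormedAddCommGroup E]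
    [NormedSpace ℝ E] [FiniteDimensional ℝ E] [NormedAddCommGroup F] [NormedSpace ℝ F]
    [FiniteDimensional ℝ F] {ι : Type*} [Fintype ι] {F₀ : E × F → ℝ} {G : ι → E × F → ℝ}
    {φ : E → ℝ} {pb : E × F} (h : IsLocalValueFunction F₀ G φ pb)
    (hF₀ : ContDiff ℝ 1 F₀) (hG : ∀ i, ContDiff ℝ 1 (G i)) {κ : ℝ} (hκ : 0 ≤ κ)
    (heb : ∀ᶠ z in 𝓝 pb, infDist z {z | ∀ i, G i z ≤ 0} ≤ κ * ∑ i, max (G i z) 0)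
    (hsing : ∀ lam : ι → ℝ, (∀ i, 0 ≤ lam i) → (∀ i, G i pb ≠ 0 → lam i = 0) →
      (∑ i, lam i • fderiv ℝ (G i) pb).comp (ContinuousLinearMap.inr ℝ E F) = 0 →
      (∑ i, lam i • fderiv ℝ (G i) pb).comp (ContinuousLinearMap.inl ℝ E F) = 0) :
    ∃ K : ℝ, ∀ᶠ x in 𝓝 pb.1, ∀ v, IsRegularSupergradient φ v x → ‖v‖ ≤ K := by
  by_contra! hcon
  have hF' : Continuous (fderiv ℝ F₀) := hF₀.continuous_fderiv one_ne_zero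
  have hG' : ∀ i, Continuous (fderiv ℝ (G i)) := fun i => (hG i).continuous_fderiv one_ne_zero
  set C : ℝ := ‖fderiv ℝ F₀ pb‖ + 1
  have hC : 0 < C := by positivity
  have hO1 : ∀ᶠ p in 𝓝 pb, ‖fderiv ℝ F₀ p‖ < C :=
    hF'.norm.continuousAt.eventually_lt continuousAt_const (lt_add_one _)
  have hO2 : ∀ᶠ p in 𝓝 pb, ∀ i, G i pb ≠ 0 → G i p ≠ 0 :=
    eventually_all.2 fun i => by
      by_cases hi : G i pb = 0
      · simp [hi]
      · exact ((hG i).continuous.continuousAt.eventually_ne hi).mono fun _ hp _ => hp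
  have hseq : ∀ k : ℕ, ∃ (v : E →L[ℝ] ℝ) (p : E × F) (mu : ι → ℝ), (k + 1 : ℝ) < ‖v‖ ∧
      dist p pb < 1 / (k + 1 : ℝ) ∧ mu ∈ Set.Icc (0 : ι → ℝ) (fun _ => κ * (C + 1)) ∧
      (∀ i, G i pb ≠ 0 → mu i = 0) ∧
      ‖v‖⁻¹ • v.comp (ContinuousLinearMap.fst ℝ E F) =
        ‖v‖⁻¹ • fderiv ℝ F₀ p - ∑ i, mu i • fderiv ℝ (G i) p := by
    intro k
    have hball : ball pb (1 / (k + 1 : ℝ)) ∈ 𝓝 pb := ball_mem_nhds pb (by positivity)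
    obtain ⟨x, ⟨v, hv, hvk⟩, hx⟩ := ((hcon (k + 1 : ℝ)).and_eventually
      (h.eventually_exists_multiplier (hF₀.differentiable one_ne_zero)
        (fun i => (hG i).differentiable one_ne_zero) hκ heb
        (inter_mem hball (inter_mem hO1 hO2)))).exists
    obtain ⟨p, ⟨hpb, hp1, hp2⟩, -, lam, hlam, hcompl, heq⟩ := hx v hv
    have hv1 : 1 ≤ ‖v‖ := by
      have : (0 : ℝ) ≤ k := k.cast_nonneg
      linarith
    have hv0 : 0 < ‖v‖ := by linarith
    have hξ : ‖fderiv ℝ F₀ p - v.comp (ContinuousLinearMap.fst ℝ E F)‖ ≤ (C + 1) * ‖v‖ := by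
      have h1 : ‖v.comp (ContinuousLinearMap.fst ℝ E F)‖ ≤ ‖v‖ * 1 :=
        (v.opNorm_comp_le _).trans (mul_le_mul_of_nonneg_left
          (ContinuousLinearMap.norm_fst_le ℝ E F) (norm_nonneg v))
      have hp1 : ‖fderiv ℝ F₀ p‖ < C := hp1
      have h2 := norm_sub_le (fderiv ℝ F₀ p) (v.comp (ContinuousLinearMap.fst ℝ E F))
      nlinarith
    refine ⟨v, p, fun i => ‖v‖⁻¹ * lam i, hvk, hpb, ⟨fun i => ?_, fun i => ?_⟩,
      fun i hi => by simp [hcompl i (hp2 i hi)], ?_⟩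
    · exact mul_nonneg (inv_nonneg.2 hv0.le) (hlam i).1
    · show ‖v‖⁻¹ * lam i ≤ κ * (C + 1)
      rw [inv_mul_le_iff₀ hv0]
      have := (hlam i).2.trans (mul_le_mul_of_nonneg_left hξ hκ)
      linarith
    · simp only [mul_smul, ← Finset.smul_sum, ← heq]
      rw [smul_sub, sub_sub_cancel]
  choose v p mu hvk hpk hmu hcompl heq using hseq
  have hp : Tendsto p atTop (𝓝 pb) := tendsto_iff_dist_tendsto_zero.2
    (squeeze_zero (fun _ => dist_nonneg) (fun k => (hpk k).le) tendsto_one_div_add_atTop_nhds_zero_nat)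
  have hvinv : Tendsto (fun k => ‖v k‖⁻¹) atTop (𝓝 0) := by
    refine tendsto_inv_atTop_zero.comp (tendsto_atTop_mono (fun k => ?_)
      tendsto_natCast_atTop_atTop)
    linarith [hvk k]
  obtain ⟨lam, hlam, s, hs, hlim⟩ := isCompact_Icc.tendsto_subseq hmu
  have hlimi := tendsto_pi_nhds.1 hlim
  have hps : Tendsto (fun k => p (s k)) atTop (𝓝 pb) := hp.comp hs.tendsto_atTop
  have hvs : Tendsto (fun k => ‖v (s k)‖⁻¹) atTop (𝓝 0) := hvinv.comp hs.tendsto_atTop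
  set Z := ∑ i, lam i • fderiv ℝ (G i) pb with hZ
  have hζ : Tendsto (fun k => ‖v (s k)‖⁻¹ • (v (s k)).comp (ContinuousLinearMap.fst ℝ E F)) atTop
      (𝓝 (-Z)) := by
    have := (hvs.smul ((hF'.tendsto pb).comp hps)).sub (tendsto_finsetSum Finset.univ
      fun i _ => (hlimi i).smul (((hG' i).tendsto pb).comp hps))
    rw [zero_smul, zero_sub] at this
    exact this.congr fun k => (heq (s k)).symm
  have hinr := ((continuous_id.clm_comp (continuous_const (y := ContinuousLinearMap.inr ℝ E F))).tendsto _).comp hζ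
  have hinl := ((continuous_id.clm_comp (continuous_const (y := ContinuousLinearMap.inl ℝ E F))).tendsto _).comp hζ
  have h0 : Z.comp (ContinuousLinearMap.inr ℝ E F) = 0 := by
    have h1 : ∀ k, (‖v (s k)‖⁻¹ • (v (s k)).comp (ContinuousLinearMap.fst ℝ E F)).comp
        (ContinuousLinearMap.inr ℝ E F) = 0 := fun k => by ext; simp
    simp only [Function.comp_def, id_eq, h1] at hinr
    have := tendsto_nhds_unique hinr tendsto_const_nhds
    rwa [ContinuousLinearMap.neg_comp, neg_eq_zero] at this
  have h1 := hsing lam (fun i => hlam.1 i) (fun i hi => tendsto_nhds_unique (hlimi i)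
    (by simp [hcompl _ i hi])) h0
  have h2 : ∀ k, (‖v (s k)‖⁻¹ • (v (s k)).comp (ContinuousLinearMap.fst ℝ E F)).comp
      (ContinuousLinearMap.inl ℝ E F) = ‖v (s k)‖⁻¹ • v (s k) := fun k => by ext; simp
  simp only [Function.comp_def, id_eq, h2] at hinl
  rw [ContinuousLinearMap.neg_comp, h1, neg_zero] at hinl
  have h3 : ∀ k, ‖‖v (s k)‖⁻¹ • v (s k)‖ = 1 := fun k => by
    have : 0 < ‖v (s k)‖ := by
      have : (0 : ℝ) ≤ s k := (s k).cast_nonneg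
      linarith [hvk (s k)]
    rw [norm_smul, norm_inv, norm_norm, inv_mul_cancel₀ this.ne']
  have h4 := hinl.norm
  simp only [h3, norm_zero] at h4
  exact one_ne_zero (tendsto_nhds_unique tendsto_const_nhds h4)

theorem IsRegularSupergradient.of_le {E : Type*} [NormedAddCommGroup E] [NormedSpace ℝ E]
    {φ θ : E → ℝ} {v : E →L[ℝ] ℝ} {x : E} (hθ : IsRegularSupergradient θ v x)
    (h : ∀ᶠ z in 𝓝 x, φ z - θ z ≤ φ x - θ x) : IsRegularSupergradient φ v x := by
  intro ε hε
  filter_upwards [hθ ε hε, h] with z h1 h2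
  linarith

/-- A local value function with bounded regular supergradients is locally Lipschitz. -/
theorem IsLocalValueFunction.exists_lipschitzOnWith {E F : Type*} [NormedAddCommGroup E]
    [InnerProductSpace ℝ E] [FiniteDimensional ℝ E] [NormedAddCommGroup F] [NormedSpace ℝ F]
    [FiniteDimensional ℝ F] {ι : Type*} [Finite ι] {F₀ : E × F → ℝ} {G : ι → E × F → ℝ}
    {φ : E → ℝ} {pb : E × F} (h : IsLocalValueFunction F₀ G φ pb)
    (hF₀ : Continuous F₀) (hG : ∀ i, Continuous (G i)) {K : ℝ}
    (hK : ∀ᶠ x in 𝓝 pb.1, ∀ v, IsRegularSupergradient φ v x → ‖v‖ ≤ K) :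
    ∃ r > 0, ∃ L : NNReal, LipschitzOnWith L φ (ball pb.1 r) := by
  have hO : ∀ᶠ p in 𝓝 pb, |F₀ p - F₀ pb| < 1 := by
    have : Continuous fun p => |F₀ p - F₀ pb| := by fun_prop
    exact this.continuousAt.eventually_lt continuousAt_const (by simp)
  have hO' : (Set.univ : Set E) ×ˢ closedBall pb.2 1 ∈ 𝓝 pb := by
    rw [nhds_prod_eq]
    exact prod_mem_prod univ_mem (closedBall_mem_nhds _ one_pos)
  obtain ⟨δ, hδ, hball⟩ := Metric.eventually_nhds_iff_ball.1
    (hK.and (h.le.and (h.attained_prod (inter_mem hO hO'))))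
  set r := δ / 4 with hr
  have hr0 : 0 < r := by positivity
  have hφ : ∀ x ∈ ball pb.1 δ, |φ x - F₀ pb| < 1 := by
    intro x hx
    obtain ⟨-, -, y, ⟨hy, -⟩, -, hφ⟩ := hball x hx
    rw [hφ]
    exact hy
  set L : ℝ := |K| + 1 + 2 / r with hL
  have hL0 : 0 < L := by positivity
  have hLr : 2 < L * r := by
    have : 2 / r * r = 2 := div_mul_cancel₀ _ hr0.ne'
    have : 0 < (|K| + 1) * r := by positivity
    rw [hL, add_mul]
    linarith
  have hcalm : ∀ a ∈ ball pb.1 (δ / 2), ∀ x ∈ closedBall a r, φ x ≤ φ a + L * ‖x - a‖ := by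
    intro a ha
    have hsub : ∀ x ∈ closedBall a r, x ∈ ball pb.1 δ := by
      intro x hx
      rw [mem_ball] at ha ⊢
      rw [mem_closedBall] at hx
      linarith [dist_triangle x a pb.1]
    have haδ : a ∈ ball pb.1 δ := hsub a (mem_closedBall_self hr0.le)
    let D : Set (E × F) := (closedBall a r ×ˢ closedBall pb.2 1) ∩ {p | ∀ i, G i p ≤ 0}
    have hD : IsCompact D := by
      refine ((isCompact_closedBall a r).prod (isCompact_closedBall pb.2 1)).inter_right ?_
      rw [Set.ofPred_forall]
      exact isClosed_iInter fun i => isClosed_le (hG i) continuous_const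
    have hlift : ∀ x ∈ closedBall a r, ∃ y, (x, y) ∈ D ∧ φ x = F₀ (x, y) := by
      intro x hx
      obtain ⟨-, -, y, ⟨-, hy⟩, hyG, hyφ⟩ := hball x (hsub x hx)
      exact ⟨y, ⟨⟨hx, hy.2⟩, hyG⟩, hyφ⟩
    obtain ⟨ya, hya, hφa⟩ := hlift a (mem_closedBall_self hr0.le)
    have hcont : Continuous fun p : E × F => F₀ p - L * ‖p.1 - a‖ := by fun_prop
    obtain ⟨⟨x₀, y₀⟩, hp₀, hmax⟩ := hD.exists_isMaxOn ⟨_, hya⟩ hcont.continuousOn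
    have hx₀ : x₀ ∈ closedBall a r := hp₀.1.1
    have hmaxφ : ∀ x ∈ closedBall a r, φ x - L * ‖x - a‖ ≤ φ x₀ - L * ‖x₀ - a‖ := by
      intro x hx
      obtain ⟨y, hy, hφx⟩ := hlift x hx
      have h1 := hmax hy
      simp only [Set.mem_ofPred_eq] at h1
      have h2 := (hball x₀ (hsub x₀ hx₀)).2.1 y₀ hp₀.2
      linarith
    have ha0 := hmaxφ a (mem_closedBall_self hr0.le)
    simp only [sub_self, norm_zero, mul_zero, sub_zero] at ha0
    have hlt : ‖x₀ - a‖ < r := by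
      by_contra! hge
      have h1 := abs_lt.1 (hφ a haδ)
      have h2 := abs_lt.1 (hφ x₀ (hsub x₀ hx₀))
      have := mul_le_mul_of_nonneg_left hge hL0.le
      linarith
    have hxa : x₀ = a := by
      by_contra hne
      have hne' : x₀ - a ≠ 0 := sub_ne_zero.2 hne
      have hd : DifferentiableAt ℝ (‖·‖) (x₀ - a) :=
        (contDiffAt_norm ℝ hne' (n := 1)).differentiableAt one_ne_zero
      set N := fderiv ℝ (‖·‖) (x₀ - a) with hN
      have hd' : HasFDerivAt (fun x => L * ‖x - a‖) (L • N) x₀ := by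
        have := (hd.hasFDerivAt.comp x₀ ((hasFDerivAt_id x₀).sub_const a)).const_mul L
        simpa [Function.comp_def] using this
      have hv : ‖L • N‖ ≤ K := by
        refine (hball x₀ (hsub x₀ hx₀)).1 _ (hd'.isRegularSupergradient.of_le ?_)
        have hx₀' : x₀ ∈ ball a r := by rwa [mem_ball, dist_eq_norm]
        filter_upwards [isOpen_ball.mem_nhds hx₀'] with z hz
        exact hmaxφ z (ball_subset_closedBall hz)
      have h1 : (L • N) (x₀ - a) = L * ‖x₀ - a‖ := by
        rw [_root_.smul_apply, hN, hd.fderiv_norm_self, smul_eq_mul]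
      have h2 := (le_abs_self _).trans ((L • N).le_opNorm (x₀ - a))
      rw [h1] at h2
      have h3 : L ≤ K := (le_of_mul_le_mul_right h2 (norm_pos_iff.2 hne')).trans hv
      have h4 : 0 < 2 / r := by positivity
      linarith [le_abs_self K]
    intro x hx
    have := hmaxφ x hx
    rw [hxa, sub_self, norm_zero, mul_zero] at this
    linarith
  refine ⟨r / 2, half_pos hr0, ⟨L, hL0.le⟩, LipschitzOnWith.of_le_add_mul _ fun x hx z hz => ?_⟩
  rw [mem_ball] at hx hz
  rw [dist_eq_norm]
  refine hcalm z (by rw [mem_ball]; linarith) x ?_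
  rw [mem_closedBall]
  linarith [dist_triangle_right x z pb.1]
/-- Near a minimizer `xb` of `φ` over `X`, with `φ` Lipschitz around `xb`, there are regular
normals to `X` that are arbitrarily close to the negatives of elements of any closed convex set
containing the derivatives of `φ` around `xb`. -/
theorem exists_regular_normal_near_of_lipschitzOnWith {E : Type*} [NormedAddCommGroup E]
    [InnerProductSpace ℝ E] [FiniteDimensional ℝ E] {φ : E → ℝ} {X : Set E} {xb : E} {L : NNReal}
    {r : ℝ} (hr : 0 < r) (hφ : LipschitzOnWith L φ (ball xb r)) (hX : IsClosed X) (hxb : xb ∈ X)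
    (hmin : IsLocalMinOn φ X xb) {A : Set (E →L[ℝ] ℝ)} (hA : IsClosed A) (hAc : Convex ℝ A)
    (hgrad : ∀ᶠ x in 𝓝 xb, DifferentiableAt ℝ φ x → fderiv ℝ φ x ∈ A) {η : ℝ} (hη : 0 < η) :
    ∃ x ∈ X, ‖x - xb‖ < η ∧ ∃ v ∈ A, ∃ w : E →L[ℝ] ℝ, ‖w + v‖ ≤ η ∧
      ∀ ε > 0, ∀ᶠ z in 𝓝 x, z ∈ X → w (z - x) ≤ ε * ‖z - x‖ := by
  obtain ⟨ψ, hψ, hφψ⟩ := hφ.extend_real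
  have hloc : ∀ᶠ x in 𝓝 xb, (DifferentiableAt ℝ φ x → fderiv ℝ φ x ∈ A) ∧
      (x ∈ X → φ xb ≤ φ x) ∧ x ∈ ball xb r :=
    hgrad.and ((eventually_nhdsWithin_iff.1 hmin).and (ball_mem_nhds xb hr))
  obtain ⟨ρ, hρ, hball⟩ := Metric.eventually_nhds_iff_ball.1 hloc
  set σ := min (ρ / 2) (η / 2)
  have hσ0 : 0 < σ := by positivity
  have hσρ : σ ≤ ρ / 2 := min_le_left _ _
  have hσ2 : σ ≤ η / 2 := min_le_right _ _
  have hψA : ∀ x ∈ ball xb ρ, DifferentiableAt ℝ ψ x → fderiv ℝ ψ x ∈ A := by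
    intro x hx hd
    have heq : φ =ᶠ[𝓝 x] ψ := by
      filter_upwards [isOpen_ball.mem_nhds (hball x hx).2.2] with z hz using hφψ hz
    rw [← heq.fderiv_eq]
    exact (hball x hx).1 (heq.differentiableAt_iff.2 hd)
  have hψmin : ∀ x ∈ ball xb ρ, x ∈ X → ψ xb ≤ ψ x := by
    intro x hx hxX
    rw [← hφψ (hball x hx).2.2, ← hφψ (mem_ball_self hr)]
    exact (hball x hx).2.1 hxX
  set e := min (ρ / 2) (σ ^ 2 / (4 * (L + 1)))
  have he0 : 0 < e := by positivity
  have heL : 2 * (L * e) < σ ^ 2 := by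
    have h1 : e ≤ σ ^ 2 / (4 * (L + 1)) := min_le_right _ _
    rw [le_div_iff₀ (by positivity)] at h1
    have := L.2
    have h2 : 0 ≤ (L : ℝ) * e := by positivity
    nlinarith
  obtain ⟨Ψ, hΨψ, hΨd, hΨA⟩ := hψ.exists_differentiable_approx he0
  have hcomp : IsCompact (X ∩ closedBall xb σ) := (isCompact_closedBall xb σ).inter_left hX
  have hcont : Continuous fun x => Ψ x + ‖x - xb‖ ^ 2 := by
    have := hΨd.continuous
    fun_prop
  obtain ⟨x, ⟨hxX, hxσ⟩, hxmin⟩ := hcomp.exists_isMinOn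
    ⟨xb, hxb, mem_closedBall_self hσ0.le⟩ hcont.continuousOn
  rw [mem_closedBall, dist_eq_norm] at hxσ
  have hxρ : x ∈ ball xb ρ := by rw [mem_ball, dist_eq_norm]; linarith
  have hxσ' : ‖x - xb‖ < σ := by
    have h1 := hxmin (show xb ∈ X ∩ closedBall xb σ from ⟨hxb, mem_closedBall_self hσ0.le⟩)
    simp only [Set.mem_ofPred_eq, sub_self, norm_zero] at h1
    have h2 := abs_le.1 (hΨψ x)
    have h3 := abs_le.1 (hΨψ xb)
    have h4 := hψmin x hxρ hxX
    refine lt_of_pow_lt_pow_left₀ 2 hσ0.le ?_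
    linarith [h2.1, h3.2]
  set T : E →L[ℝ] ℝ := 2 • (innerSL ℝ (x - xb)) with hT
  have hTd : HasFDerivAt (fun x => Ψ x + ‖x - xb‖ ^ 2) (fderiv ℝ Ψ x + T) x := by
    have h1 := ((hasFDerivAt_id x).sub_const xb).norm_sq
    exact (hΨd x).hasFDerivAt.add (by simpa [hT] using h1)
  refine ⟨x, hxX, by linarith, fderiv ℝ Ψ x, hΨA x A hA hAc fun z hz hd => hψA z ?_ hd,
    -(fderiv ℝ Ψ x + T), ?_, ?_⟩
  · rw [mem_ball, dist_eq_norm]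
    have : ‖z - xb‖ ≤ ‖z - x‖ + ‖x - xb‖ := norm_sub_le_norm_sub_add_norm_sub _ _ _
    have : e ≤ ρ / 2 := min_le_left _ _
    linarith
  · have h1 : -(fderiv ℝ Ψ x + T) + fderiv ℝ Ψ x = -T := by abel
    have h2 : ‖T‖ ≤ 2 * ‖x - xb‖ := by
      rw [hT, two_smul, two_mul]
      refine (norm_add_le _ _).trans ?_
      rw [innerSL_apply_norm]
    rw [h1, norm_neg]
    linarith
  · intro ε hε
    have hxσ'' : x ∈ ball xb σ := by rwa [mem_ball, dist_eq_norm]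
    filter_upwards [hTd.isRegularSupergradient ε hε, isOpen_ball.mem_nhds hxσ''] with z h1 hz hzX
    have h2 := hxmin (show z ∈ X ∩ closedBall xb σ from ⟨hzX, ball_subset_closedBall hz⟩)
    simp only [Set.mem_ofPred_eq] at h2
    rw [_root_.neg_apply]
    linarith

/-- The functionals `v` on `E` such that `(v, 0)` is within `η` of the derivative of a Lagrangian
with derivatives `F'` of the objective and `G'` of the constraints, and multiplier in `Λ`. -/
def approxLagrangeGradients {E F ι : Type*} [NormedAddCommGroup E] [NormedSpace ℝ E]
    [NormedAddCommGroup F] [NormedSpace ℝ F] [Fintype ι] (F' : E × F →L[ℝ] ℝ)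
    (G' : ι → E × F →L[ℝ] ℝ) (Λ : Set (ι → ℝ)) (η : ℝ) : Set (E →L[ℝ] ℝ) :=
  {v | ∃ lam ∈ Λ, ‖v.comp (ContinuousLinearMap.fst ℝ E F) - (F' - ∑ i, lam i • G' i)‖ ≤ η}

theorem isClosed_approxLagrangeGradients {E F ι : Type*} [NormedAddCommGroup E] [NormedSpace ℝ E]
    [NormedAddCommGroup F] [NormedSpace ℝ F] [Fintype ι] (F' : E × F →L[ℝ] ℝ)
    (G' : ι → E × F →L[ℝ] ℝ) {Λ : Set (ι → ℝ)} (hΛ : IsCompact Λ) (η : ℝ) :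
    IsClosed (approxLagrangeGradients F' G' Λ η) := by
  have hfst : Continuous fun v : E →L[ℝ] ℝ => v.comp (ContinuousLinearMap.fst ℝ E F) :=
    continuous_id.clm_comp continuous_const
  have hD : Continuous fun lam : ι → ℝ => F' - ∑ i, lam i • G' i := by fun_prop
  have h1 : IsClosed {q : (E →L[ℝ] ℝ) × Λ |
      ‖q.1.comp (ContinuousLinearMap.fst ℝ E F) - (F' - ∑ i, (q.2 : ι → ℝ) i • G' i)‖ ≤ η} :=
    isClosed_le (((hfst.comp continuous_fst).sub
      (hD.comp (continuous_subtype_val.comp continuous_snd))).norm) continuous_const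
  have : CompactSpace Λ := isCompact_iff_compactSpace.1 hΛ
  convert isClosedMap_fst_of_compactSpace _ h1 using 1
  ext v
  simp [approxLagrangeGradients]

theorem convex_approxLagrangeGradients {E F ι : Type*} [NormedAddCommGroup E] [NormedSpace ℝ E]
    [NormedAddCommGroup F] [NormedSpace ℝ F] [Fintype ι] (F' : E × F →L[ℝ] ℝ)
    (G' : ι → E × F →L[ℝ] ℝ) {Λ : Set (ι → ℝ)} (hΛ : Convex ℝ Λ) (η : ℝ) :
    Convex ℝ (approxLagrangeGradients F' G' Λ η) := by
  rintro v₁ ⟨l₁, hl₁, h₁⟩ v₂ ⟨l₂, hl₂, h₂⟩ s t hs ht hst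
  refine ⟨s • l₁ + t • l₂, hΛ hl₁ hl₂ hs ht hst, ?_⟩
  have hsum : ∑ i, (s • l₁ + t • l₂) i • G' i = s • ∑ i, l₁ i • G' i + t • ∑ i, l₂ i • G' i := by
    simp only [Pi.add_apply, Pi.smul_apply, smul_eq_mul, add_smul, mul_smul,
      Finset.sum_add_distrib, Finset.smul_sum]
  have hF' : F' = s • F' + t • F' := by rw [← add_smul, hst, one_smul]
  set c₁ := ∑ i, l₁ i • G' i
  set c₂ := ∑ i, l₂ i • G' i
  have heq : (s • v₁ + t • v₂).comp (ContinuousLinearMap.fst ℝ E F) -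
      (F' - ∑ i, (s • l₁ + t • l₂) i • G' i) =
      s • (v₁.comp (ContinuousLinearMap.fst ℝ E F) - (F' - c₁)) +
        t • (v₂.comp (ContinuousLinearMap.fst ℝ E F) - (F' - c₂)) := by
    rw [hsum, ContinuousLinearMap.add_comp, ContinuousLinearMap.smul_comp,
      ContinuousLinearMap.smul_comp]
    nth_rewrite 1 [hF']
    module
  rw [heq]
  calc _ ≤ s * ‖v₁.comp (ContinuousLinearMap.fst ℝ E F) - (F' - c₁)‖ +
        t * ‖v₂.comp (ContinuousLinearMap.fst ℝ E F) - (F' - c₂)‖ := by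
        refine (norm_add_le _ _).trans ?_
        rw [norm_smul, norm_smul, Real.norm_of_nonneg hs, Real.norm_of_nonneg ht]
    _ ≤ s * η + t * η := by gcongr
    _ = η := by rw [← add_mul, hst, one_mul]

/-- Derivatives of a local value function with bounded supergradients are nearly derivatives of
Lagrangians at the reference point, with multipliers in a fixed box. -/
theorem IsLocalValueFunction.exists_eventually_fderiv_mem {E F : Type*} [NormedAddCommGroup E]
    [NormedSpace ℝ E] [FiniteDimensional ℝ E] [NormedAddCommGroup F] [NormedSpace ℝ F]
    [FiniteDimensional ℝ F] {ι : Type*} [Fintype ι] {F₀ : E × F → ℝ} {G : ι → E × F → ℝ}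
    {φ : E → ℝ} {pb : E × F} (h : IsLocalValueFunction F₀ G φ pb)
    (hF₀ : ContDiff ℝ 1 F₀) (hG : ∀ i, ContDiff ℝ 1 (G i)) {κ : ℝ} (hκ : 0 ≤ κ)
    (heb : ∀ᶠ z in 𝓝 pb, infDist z {z | ∀ i, G i z ≤ 0} ≤ κ * ∑ i, max (G i z) 0) {K : ℝ}
    (hK : ∀ᶠ x in 𝓝 pb.1, ∀ v, IsRegularSupergradient φ v x → ‖v‖ ≤ K) :
    ∃ b : ι → ℝ, (∀ i, G i pb ≠ 0 → b i = 0) ∧ ∀ η > 0, ∀ᶠ x in 𝓝 pb.1,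
      DifferentiableAt ℝ φ x → fderiv ℝ φ x ∈ approxLagrangeGradients (fderiv ℝ F₀ pb)
        (fun i => fderiv ℝ (G i) pb) (Set.Icc 0 b) η := by
  classical
  have hF' : Continuous (fderiv ℝ F₀) := hF₀.continuous_fderiv one_ne_zero
  have hG' : ∀ i, Continuous (fderiv ℝ (G i)) := fun i => (hG i).continuous_fderiv one_ne_zero
  set B : ℝ := κ * (‖fderiv ℝ F₀ pb‖ + 1 + |K|)
  refine ⟨fun i => if G i pb = 0 then B else 0, fun i hi => if_neg hi, fun η hη => ?_⟩
  have hO1 : ∀ᶠ p in 𝓝 pb, ‖fderiv ℝ F₀ p‖ < ‖fderiv ℝ F₀ pb‖ + 1 :=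
    hF'.norm.continuousAt.eventually_lt continuousAt_const (lt_add_one _)
  have hO2 : ∀ᶠ p in 𝓝 pb, ∀ i, G i pb ≠ 0 → G i p ≠ 0 :=
    eventually_all.2 fun i => by
      by_cases hi : G i pb = 0
      · simp [hi]
      · exact ((hG i).continuous.continuousAt.eventually_ne hi).mono fun _ hp _ => hp
  have hO3 : ∀ᶠ p in 𝓝 pb, ‖fderiv ℝ F₀ p - fderiv ℝ F₀ pb‖ +
      B * ∑ i, ‖fderiv ℝ (G i) p - fderiv ℝ (G i) pb‖ < η := by
    have : Continuous fun p => ‖fderiv ℝ F₀ p - fderiv ℝ F₀ pb‖ +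
      B * ∑ i, ‖fderiv ℝ (G i) p - fderiv ℝ (G i) pb‖ := by fun_prop
    exact this.continuousAt.eventually_lt continuousAt_const (by simpa using hη)
  filter_upwards [hK, h.eventually_exists_multiplier (hF₀.differentiable one_ne_zero)
    (fun i => (hG i).differentiable one_ne_zero) hκ heb
    (inter_mem hO1 (inter_mem hO2 hO3))] with x hxK hx hd
  have hsg := hd.hasFDerivAt.isRegularSupergradient
  obtain ⟨p, ⟨hp1, hp2, hp3⟩, -, lam, hlam, hcompl, heq⟩ := hx _ hsg
  set v := fderiv ℝ φ x
  have hp1 : ‖fderiv ℝ F₀ p‖ < ‖fderiv ℝ F₀ pb‖ + 1 := hp1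
  have hp3 : ‖fderiv ℝ F₀ p - fderiv ℝ F₀ pb‖ +
    B * ∑ i, ‖fderiv ℝ (G i) p - fderiv ℝ (G i) pb‖ < η := hp3
  have hξ : ‖fderiv ℝ F₀ p - v.comp (ContinuousLinearMap.fst ℝ E F)‖ ≤ ‖fderiv ℝ F₀ pb‖ + 1 + |K| := by
    have h1 : ‖v.comp (ContinuousLinearMap.fst ℝ E F)‖ ≤ ‖v‖ * 1 :=
      (v.opNorm_comp_le _).trans (mul_le_mul_of_nonneg_left
        (ContinuousLinearMap.norm_fst_le ℝ E F) (norm_nonneg v))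
    have h2 := norm_sub_le (fderiv ℝ F₀ p) (v.comp (ContinuousLinearMap.fst ℝ E F))
    linarith [hxK _ hsg, le_abs_self K]
  have hlamB : ∀ i, lam i ≤ B := fun i =>
    (hlam i).2.trans (mul_le_mul_of_nonneg_left hξ hκ)
  refine ⟨lam, ⟨fun i => (hlam i).1, fun i => ?_⟩, ?_⟩
  · by_cases hi : G i pb = 0
    · simpa [hi] using hlamB i
    · simp [hi, hcompl i (hp2 i hi)]
  · have h1 : v.comp (ContinuousLinearMap.fst ℝ E F) -
        (fderiv ℝ F₀ pb - ∑ i, lam i • fderiv ℝ (G i) pb) =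
        (fderiv ℝ F₀ p - fderiv ℝ F₀ pb) -
          ∑ i, lam i • (fderiv ℝ (G i) p - fderiv ℝ (G i) pb) := by
      have h2 : v.comp (ContinuousLinearMap.fst ℝ E F) =
          fderiv ℝ F₀ p - ∑ i, lam i • fderiv ℝ (G i) p := by
        rw [← heq, sub_sub_cancel]
      simp only [h2, smul_sub, Finset.sum_sub_distrib]
      abel
    rw [h1]
    refine (norm_sub_le _ _).trans (le_trans (add_le_add_right ?_ _) hp3.le)
    rw [Finset.mul_sum]
    refine norm_sum_le_of_le _ fun i _ => ?_
    rw [norm_smul, Real.norm_of_nonneg (hlam i).1]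
    exact mul_le_mul_of_nonneg_right (hlamB i) (norm_nonneg _)

theorem exists_subseq_tendsto_of_mem_approxLagrangeGradients {E F ι : Type*}
    [NormedAddCommGroup E] [NormedSpace ℝ E] [NormedAddCommGroup F] [NormedSpace ℝ F] [Fintype ι]
    {F' : E × F →L[ℝ] ℝ} {G' : ι → E × F →L[ℝ] ℝ} {Λ : Set (ι → ℝ)} (hΛ : IsCompact Λ)
    {η : ℕ → ℝ} (hη : Tendsto η atTop (𝓝 0)) {v : ℕ → E →L[ℝ] ℝ}
    (hv : ∀ k, v k ∈ approxLagrangeGradients F' G' Λ (η k)) :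
    ∃ lam ∈ Λ, (F' - ∑ i, lam i • G' i).comp (ContinuousLinearMap.inr ℝ E F) = 0 ∧
      ∃ s : ℕ → ℕ, StrictMono s ∧ Tendsto (v ∘ s) atTop
        (𝓝 ((F' - ∑ i, lam i • G' i).comp (ContinuousLinearMap.inl ℝ E F))) := by
  choose l hl hvl using hv
  obtain ⟨lam, hlam, s, hs, hlim⟩ := hΛ.tendsto_subseq hl
  have hD : Continuous fun lam : ι → ℝ => F' - ∑ i, lam i • G' i := by fun_prop
  have hDlim : Tendsto (fun k => F' - ∑ i, l (s k) i • G' i) atTop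
      (𝓝 (F' - ∑ i, lam i • G' i)) := (hD.tendsto lam).comp hlim
  have hvlim : Tendsto (fun k => (v (s k)).comp (ContinuousLinearMap.fst ℝ E F)) atTop
      (𝓝 (F' - ∑ i, lam i • G' i)) := by
    have h1 : Tendsto (fun k => (v (s k)).comp (ContinuousLinearMap.fst ℝ E F) -
        (F' - ∑ i, l (s k) i • G' i)) atTop (𝓝 0) :=
      squeeze_zero_norm (fun k => hvl (s k)) (hη.comp hs.tendsto_atTop)
    simpa using h1.add hDlim
  have hinr := ((continuous_id.clm_comp
    (continuous_const (y := ContinuousLinearMap.inr ℝ E F))).tendsto _).comp hvlim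
  have hinl := ((continuous_id.clm_comp
    (continuous_const (y := ContinuousLinearMap.inl ℝ E F))).tendsto _).comp hvlim
  have h1 : ∀ k, ((v (s k)).comp (ContinuousLinearMap.fst ℝ E F)).comp
      (ContinuousLinearMap.inr ℝ E F) = 0 := fun k => by ext; simp
  have h2 : ∀ k, ((v (s k)).comp (ContinuousLinearMap.fst ℝ E F)).comp
      (ContinuousLinearMap.inl ℝ E F) = v (s k) := fun k => by ext; simp
  simp only [Function.comp_def, id_eq, h1] at hinr
  simp only [Function.comp_def, id_eq, h2] at hinl
  exact ⟨lam, hlam, tendsto_nhds_unique hinr tendsto_const_nhds, s, hs, hinl⟩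

/-- Abstract first-order condition for minimizing a local value function over a closed set. -/
theorem IsLocalValueFunction.exists_multiplier_of_isLocalMinOn {E F : Type*}
    [NormedAddCommGroup E] [InnerProductSpace ℝ E] [FiniteDimensional ℝ E]
    [NormedAddCommGroup F] [NormedSpace ℝ F] [FiniteDimensional ℝ F] {ι : Type*} [Fintype ι]
    {F₀ : E × F → ℝ} {G : ι → E × F → ℝ} {φ : E → ℝ} {pb : E × F}
    (h : IsLocalValueFunction F₀ G φ pb) (hF₀ : ContDiff ℝ 1 F₀) (hG : ∀ i, ContDiff ℝ 1 (G i))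
    {κ : ℝ} (hκ : 0 ≤ κ)
    (heb : ∀ᶠ z in 𝓝 pb, infDist z {z | ∀ i, G i z ≤ 0} ≤ κ * ∑ i, max (G i z) 0)
    (hsing : ∀ lam : ι → ℝ, (∀ i, 0 ≤ lam i) → (∀ i, G i pb ≠ 0 → lam i = 0) →
      (∑ i, lam i • fderiv ℝ (G i) pb).comp (ContinuousLinearMap.inr ℝ E F) = 0 →
      (∑ i, lam i • fderiv ℝ (G i) pb).comp (ContinuousLinearMap.inl ℝ E F) = 0)
    {X : Set E} (hX : IsClosed X) (hxb : pb.1 ∈ X) (hmin : IsLocalMinOn φ X pb.1) :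
    ∃ lam : ι → ℝ, (∀ i, 0 ≤ lam i) ∧ (∀ i, G i pb ≠ 0 → lam i = 0) ∧
      (fderiv ℝ F₀ pb - ∑ i, lam i • fderiv ℝ (G i) pb).comp
        (ContinuousLinearMap.inr ℝ E F) = 0 ∧
      ∃ (x : ℕ → E) (w : ℕ → E →L[ℝ] ℝ), (∀ k, x k ∈ X) ∧ Tendsto x atTop (𝓝 pb.1) ∧
        (∀ k, ∀ ε > 0, ∀ᶠ z in 𝓝 (x k), z ∈ X → w k (z - x k) ≤ ε * ‖z - x k‖) ∧
        Tendsto w atTop (𝓝 (-(fderiv ℝ F₀ pb - ∑ i, lam i • fderiv ℝ (G i) pb).comp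
          (ContinuousLinearMap.inl ℝ E F))) := by
  obtain ⟨K, hK⟩ := h.exists_bound_supergradient hF₀ hG hκ heb hsing
  obtain ⟨r, hr, L, hL⟩ := h.exists_lipschitzOnWith hF₀.continuous
    (fun i => (hG i).continuous) hK
  obtain ⟨b, hb, hgrad⟩ := h.exists_eventually_fderiv_mem hF₀ hG hκ heb hK
  have hη : ∀ k : ℕ, (0 : ℝ) < 1 / (k + 1 : ℝ) := fun k => by positivity
  choose x hxX hx v hv w hwv hw using fun k : ℕ =>
    exists_regular_normal_near_of_lipschitzOnWith hr hL hX hxb hmin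
      (isClosed_approxLagrangeGradients _ _ isCompact_Icc _)
      (convex_approxLagrangeGradients _ _ (convex_Icc _ _) _) (hgrad _ (hη k)) (hη k)
  have hzero : Tendsto (fun k : ℕ => 1 / (k + 1 : ℝ)) atTop (𝓝 0) :=
    tendsto_one_div_add_atTop_nhds_zero_nat
  obtain ⟨lam, hlam, hinr, s, hs, hinl⟩ :=
    exists_subseq_tendsto_of_mem_approxLagrangeGradients isCompact_Icc hzero hv
  refine ⟨lam, fun i => hlam.1 i, fun i hi => le_antisymm ((hlam.2 i).trans_eq (hb i hi))
    (hlam.1 i), hinr, x ∘ s, w ∘ s, fun k => hxX _, ?_, fun k => hw _, ?_⟩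
  · have h1 : Tendsto x atTop (𝓝 pb.1) := by
      rw [tendsto_iff_norm_sub_tendsto_zero]
      exact squeeze_zero (fun _ => norm_nonneg _) (fun k => (hx k).le) hzero
    exact h1.comp hs.tendsto_atTop
  · have h1 : Tendsto (fun k => w k + v k) atTop (𝓝 0) := squeeze_zero_norm hwv hzero
    have h2 := (h1.comp hs.tendsto_atTop).sub hinl
    simp only [Function.comp_def, add_sub_cancel_right, zero_sub] at h2
    exact h2

theorem gradx_eq {n m : ℕ} {φ : EuclideanSpace ℝ (Fin n) → EuclideanSpace ℝ (Fin m) → ℝ}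
    {x : EuclideanSpace ℝ (Fin n)} {y : EuclideanSpace ℝ (Fin m)}
    {D : EuclideanSpace ℝ (Fin n) × EuclideanSpace ℝ (Fin m) →L[ℝ] ℝ}
    (h : HasFDerivAt (fun p : EuclideanSpace ℝ (Fin n) × EuclideanSpace ℝ (Fin m) => φ p.1 p.2)
      D (x, y)) :
    gradx φ x y = (InnerProductSpace.toDual ℝ _).symm (D.comp (ContinuousLinearMap.inl ℝ _ _)) := by
  have h1 : HasFDerivAt (fun x' => φ x' y) (D.comp (ContinuousLinearMap.inl ℝ _ _)) x :=
    HasFDerivAt.comp (f := fun x' => (x', y)) x h (hasFDerivAt_prodMk_left x y)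
  rw [gradx, gradient, h1.fderiv]

theorem grady_eq {n m : ℕ} {φ : EuclideanSpace ℝ (Fin n) → EuclideanSpace ℝ (Fin m) → ℝ}
    {x : EuclideanSpace ℝ (Fin n)} {y : EuclideanSpace ℝ (Fin m)}
    {D : EuclideanSpace ℝ (Fin n) × EuclideanSpace ℝ (Fin m) →L[ℝ] ℝ}
    (h : HasFDerivAt (fun p : EuclideanSpace ℝ (Fin n) × EuclideanSpace ℝ (Fin m) => φ p.1 p.2)
      D (x, y)) :
    grady φ x y = (InnerProductSpace.toDual ℝ _).symm (D.comp (ContinuousLinearMap.inr ℝ _ _)) := by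
  have h1 : HasFDerivAt (fun y' => φ x y') (D.comp (ContinuousLinearMap.inr ℝ _ _)) y :=
    HasFDerivAt.comp (f := fun y' => (x, y')) y h (hasFDerivAt_prodMk_right x y)
  rw [grady, gradient, h1.fderiv]

theorem toReal_Vfun {n m q : ℕ} {f : EuclideanSpace ℝ (Fin n) → EuclideanSpace ℝ (Fin m) → ℝ}
    {g : EuclideanSpace ℝ (Fin n) → EuclideanSpace ℝ (Fin m) → Fin q → ℝ}
    {x : EuclideanSpace ℝ (Fin n)} {y : EuclideanSpace ℝ (Fin m)} (hy : y ∈ Sol f g x) :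
    (Vfun f g x).toReal = f x y := by
  rw [← hy.2, EReal.toReal_coe]

theorem le_toReal_Vfun {n m q : ℕ} {f : EuclideanSpace ℝ (Fin n) → EuclideanSpace ℝ (Fin m) → ℝ}
    {g : EuclideanSpace ℝ (Fin n) → EuclideanSpace ℝ (Fin m) → Fin q → ℝ}
    {x : EuclideanSpace ℝ (Fin n)} {y y' : EuclideanSpace ℝ (Fin m)} (hy : y ∈ Sol f g x)
    (hy' : y' ∈ Feas g x) : f x y' ≤ (Vfun f g x).toReal := by
  rw [toReal_Vfun hy, ← EReal.coe_le_coe_iff, hy.2]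
  exact le_sSup (Set.mem_image_of_mem _ hy')

theorem InnerSemicont.eventually_exists {n m q : ℕ}
    {f : EuclideanSpace ℝ (Fin n) → EuclideanSpace ℝ (Fin m) → ℝ}
    {g : EuclideanSpace ℝ (Fin n) → EuclideanSpace ℝ (Fin m) → Fin q → ℝ}
    {xb : EuclideanSpace ℝ (Fin n)} {yb : EuclideanSpace ℝ (Fin m)}
    (h : InnerSemicont f g xb yb) {U : Set (EuclideanSpace ℝ (Fin m))} (hU : U ∈ 𝓝 yb) :
    ∀ᶠ x in 𝓝 xb, ∃ y ∈ U, y ∈ Sol f g x := by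
  by_contra hcon
  obtain ⟨xk, hxk, hno⟩ := exists_seq_forall_of_frequently (not_eventually.1 hcon)
  obtain ⟨yk, hyk, hlim⟩ := h xk hxk
  obtain ⟨k, hk⟩ := (hlim.eventually_mem hU).exists
  exact hno k ⟨yk k, hk, hyk k⟩

theorem InnerSemicont.isLocalValueFunction {n m q : ℕ}
    {f : EuclideanSpace ℝ (Fin n) → EuclideanSpace ℝ (Fin m) → ℝ}
    {g : EuclideanSpace ℝ (Fin n) → EuclideanSpace ℝ (Fin m) → Fin q → ℝ}
    {xb : EuclideanSpace ℝ (Fin n)} {yb : EuclideanSpace ℝ (Fin m)}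
    (h : InnerSemicont f g xb yb) :
    IsLocalValueFunction
      (fun p : EuclideanSpace ℝ (Fin n) × EuclideanSpace ℝ (Fin m) => f p.1 p.2)
      (fun i p => g p.1 p.2 i) (fun x => (Vfun f g x).toReal) (xb, yb) where
  le := by
    filter_upwards [h.eventually_exists univ_mem] with x hx y' hy'
    obtain ⟨y, -, hy⟩ := hx
    exact le_toReal_Vfun hy hy'
  attained U hU := by
    filter_upwards [h.eventually_exists hU] with x hx
    obtain ⟨y, hyU, hy⟩ := hx
    exact ⟨y, hyU, hy.1, toReal_Vfun hy⟩

theorem InnerSemicont.isLocalMinOn_toReal {n m q : ℕ}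
    {f : EuclideanSpace ℝ (Fin n) → EuclideanSpace ℝ (Fin m) → ℝ}
    {g : EuclideanSpace ℝ (Fin n) → EuclideanSpace ℝ (Fin m) → Fin q → ℝ}
    {xb : EuclideanSpace ℝ (Fin n)} {yb : EuclideanSpace ℝ (Fin m)}
    (h : InnerSemicont f g xb yb) (hyb : yb ∈ Sol f g xb) {X : Set (EuclideanSpace ℝ (Fin n))}
    (hmin : IsLocalMinOn (Vfun f g) X xb) :
    IsLocalMinOn (fun x => (Vfun f g x).toReal) X xb := by
  filter_upwards [hmin, mem_nhdsWithin_of_mem_nhds (h.eventually_exists univ_mem)] with x hx hy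
  obtain ⟨y, -, hy⟩ := hy
  rw [toReal_Vfun hyb, toReal_Vfun hy, ← EReal.coe_le_coe_iff, hyb.2, hy.2]
  exact hx

theorem LocalErrorBound.eventually_le {n m q : ℕ}
    {g : EuclideanSpace ℝ (Fin n) → EuclideanSpace ℝ (Fin m) → Fin q → ℝ}
    {xb : EuclideanSpace ℝ (Fin n)} {yb : EuclideanSpace ℝ (Fin m)}
    (h : LocalErrorBound g xb yb) :
    ∃ κ : ℝ, 0 ≤ κ ∧ ∀ᶠ z : EuclideanSpace ℝ (Fin n) × EuclideanSpace ℝ (Fin m) in 𝓝 (xb, yb),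
      infDist z {p : EuclideanSpace ℝ (Fin n) × EuclideanSpace ℝ (Fin m) |
        ∀ i, g p.1 p.2 i ≤ 0} ≤ κ * ∑ i, max (g z.1 z.2 i) 0 := by
  obtain ⟨κ, δ, hκ, hδ, hle⟩ := h
  refine ⟨κ, hκ.le, ?_⟩
  filter_upwards [ball_mem_nhds _ hδ] with z hz
  rw [mem_ball, dist_eq_norm] at hz
  exact hle z.1 z.2 hz

theorem toDual_symm_mem_regNC {n : ℕ} {X : Set (EuclideanSpace ℝ (Fin n))}
    {x : EuclideanSpace ℝ (Fin n)} {w : EuclideanSpace ℝ (Fin n) →L[ℝ] ℝ}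
    (hw : ∀ ε > 0, ∀ᶠ z in 𝓝 x, z ∈ X → w (z - x) ≤ ε * ‖z - x‖) :
    (InnerProductSpace.toDual ℝ _).symm w ∈ regNC X x := by
  intro ε hε
  obtain ⟨δ, hδ, h⟩ := Metric.eventually_nhds_iff.1 (hw ε hε)
  refine ⟨δ, hδ, fun z hz hzx => ?_⟩
  rw [InnerProductSpace.toDual_symm_apply]
  exact h (by rwa [dist_eq_norm]) hz

/-- Theorem 4.6 — optimality condition under inner semicontinuity of the
solution map. -/
theorem stmt18 {n m q : ℕ}
    (f : EuclideanSpace ℝ (Fin n) → EuclideanSpace ℝ (Fin m) → ℝ)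
    (g : EuclideanSpace ℝ (Fin n) → EuclideanSpace ℝ (Fin m) → Fin q → ℝ)
    (hf : ContDiff ℝ 1 (fun p : EuclideanSpace ℝ (Fin n) × EuclideanSpace ℝ (Fin m) => f p.1 p.2))
    (hg : ∀ i, ContDiff ℝ 1
      (fun p : EuclideanSpace ℝ (Fin n) × EuclideanSpace ℝ (Fin m) => g p.1 p.2 i))
    (X : Set (EuclideanSpace ℝ (Fin n))) (hXc : IsClosed X)
    (xb : EuclideanSpace ℝ (Fin n)) (yb : EuclideanSpace ℝ (Fin m))
    (hstack : StackelbergLocal f g X xb yb)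
    (hisc : InnerSemicont f g xb yb)
    (heb : LocalErrorBound g xb yb)
    (hsig : {v | ∃ lam ∈ SigmaZero g xb yb,
      v = ∑ i, lam i • gradx (fun x y => g x y i) xb yb} = {0}) :
    ∃ lamb : Fin q → ℝ,
      -(gradxL f g xb yb lamb) ∈ limNC X xb ∧
      gradyL f g xb yb lamb = 0 ∧ (∀ i, 0 ≤ lamb i) ∧ (∀ i, g xb yb i ≤ 0) ∧
      ∑ i, lamb i * g xb yb i = 0 := by
  obtain ⟨hxX, hyb, hmin⟩ := hstack
  obtain ⟨κ, hκ, hle⟩ := heb.eventually_le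
  set pb : EuclideanSpace ℝ (Fin n) × EuclideanSpace ℝ (Fin m) := (xb, yb)
  set F₀ : EuclideanSpace ℝ (Fin n) × EuclideanSpace ℝ (Fin m) → ℝ := fun p => f p.1 p.2
  set G : Fin q → EuclideanSpace ℝ (Fin n) × EuclideanSpace ℝ (Fin m) → ℝ :=
    fun i p => g p.1 p.2 i
  have hF' : HasFDerivAt F₀ (fderiv ℝ F₀ pb) pb := (hf.differentiable one_ne_zero pb).hasFDerivAt
  have hG' : ∀ i, HasFDerivAt (G i) (fderiv ℝ (G i) pb) pb :=
    fun i => ((hg i).differentiable one_ne_zero pb).hasFDerivAt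
  have hcompl : ∀ lam : Fin q → ℝ, (∀ i, G i pb ≠ 0 → lam i = 0) →
      ∑ i, lam i * g xb yb i = 0 := fun lam hlam => Finset.sum_eq_zero fun i _ => by
    by_cases hi : g xb yb i = 0
    · rw [hi, mul_zero]
    · rw [hlam i hi, zero_mul]
  have hsumx : ∀ lam : Fin q → ℝ, ∑ i, lam i • gradx (fun x y => g x y i) xb yb =
      (InnerProductSpace.toDual ℝ _).symm ((∑ i, lam i • fderiv ℝ (G i) pb).comp
        (ContinuousLinearMap.inl ℝ _ _)) := fun lam => by
    have h1 : ∀ i, gradx (fun x y => g x y i) xb yb = (InnerProductSpace.toDual ℝ _).symm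
        ((fderiv ℝ (G i) pb).comp (ContinuousLinearMap.inl ℝ _ _)) := fun i => gradx_eq (hG' i)
    simp only [h1, ContinuousLinearMap.finsetSum_comp,
      ContinuousLinearMap.smul_comp, map_sum, map_smulₛₗ, conj_trivial]
  have hsumy : ∀ lam : Fin q → ℝ, ∑ i, lam i • grady (fun x y => g x y i) xb yb =
      (InnerProductSpace.toDual ℝ _).symm ((∑ i, lam i • fderiv ℝ (G i) pb).comp
        (ContinuousLinearMap.inr ℝ _ _)) := fun lam => by
    have h1 : ∀ i, grady (fun x y => g x y i) xb yb = (InnerProductSpace.toDual ℝ _).symm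
        ((fderiv ℝ (G i) pb).comp (ContinuousLinearMap.inr ℝ _ _)) := fun i => grady_eq (hG' i)
    simp only [h1, ContinuousLinearMap.finsetSum_comp,
      ContinuousLinearMap.smul_comp, map_sum, map_smulₛₗ, conj_trivial]
  have hsing : ∀ lam : Fin q → ℝ, (∀ i, 0 ≤ lam i) → (∀ i, G i pb ≠ 0 → lam i = 0) →
      (∑ i, lam i • fderiv ℝ (G i) pb).comp (ContinuousLinearMap.inr ℝ _ _) = 0 →
      (∑ i, lam i • fderiv ℝ (G i) pb).comp (ContinuousLinearMap.inl ℝ _ _) = 0 := by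
    intro lam hpos hlam hinr
    have hmem : ∑ i, lam i • gradx (fun x y => g x y i) xb yb ∈
        {v | ∃ lam ∈ SigmaZero g xb yb, v = ∑ i, lam i • gradx (fun x y => g x y i) xb yb} :=
      ⟨lam, ⟨by rw [hsumy, hinr, map_zero], hpos, hyb.1, hcompl lam hlam⟩, rfl⟩
    rw [hsig, Set.mem_singleton_iff, hsumx] at hmem
    exact (map_eq_zero_iff _ (LinearIsometryEquiv.injective _)).1 hmem
  obtain ⟨lam, hpos, hlam, hinr, x, w, hx, hxlim, hw, hwlim⟩ :=
    hisc.isLocalValueFunction.exists_multiplier_of_isLocalMinOn hf hg hκ hle hsing hXc hxX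
      (hisc.isLocalMinOn_toReal hyb hmin)
  have hL : HasFDerivAt (fun p : EuclideanSpace ℝ (Fin n) × EuclideanSpace ℝ (Fin m) =>
      Lag f g p.1 p.2 lam) (fderiv ℝ F₀ pb - ∑ i, lam i • fderiv ℝ (G i) pb) pb :=
    hF'.sub (HasFDerivAt.fun_sum fun i _ => (hG' i).const_mul (lam i))
  refine ⟨lam, ⟨x, fun k => (InnerProductSpace.toDual ℝ _).symm (w k), hx,
    fun k => toDual_symm_mem_regNC (hw k), hxlim, ?_⟩, ?_, hpos, hyb.1, hcompl lam hlam⟩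
  · rw [gradxL, gradx_eq hL, ← map_neg]
    exact ((InnerProductSpace.toDual ℝ _).symm.continuous.tendsto _).comp hwlim
  · rw [gradyL, grady_eq hL, hinr, map_zero]
end

section
/- Let X ⊆ ℝⁿ be closed and let (x̄,ȳ) be a local solution of the minimax problem min_{x∈X} max_{y∈F(x)} f(x,y) in the sense of Stackelberg. Suppose f is jointly concave on ℝⁿ×ℝᵐ, each g_i is jointly quasiconvex in (x,y), there is an open set O containing x̄ such that for every x ∈ O, F(x) ≠ ∅ and f(x,·) is bounded above on F(x), and a CQ holds for the system g(x,y) ≤ 0 (in the joint variable (x,y)) at (x̄,ȳ). Then there exists λ̄ ∈ ℝ^q such that 0 ∈ ∇_x L(x̄,ȳ,λ̄) + N_X(x̄), ∇_y L(x̄,ȳ,λ̄) = 0, λ̄ ≥ 0, g(x̄,ȳ) ≤ 0, and λ̄ᵀg(x̄,ȳ) = 0. -/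
open Filter Topology Metric RealInnerProductSpace

/-- A concave function on an open convex set of a finite-dimensional space has a supergradient at
every point of the set. -/
theorem ConcaveOn.exists_supergradient {E : Type*} [NormedAddCommGroup E] [NormedSpace ℝ E]
    [FiniteDimensional ℝ E] {s : Set E} {v : E → ℝ} (hs : IsOpen s) (hv : ConcaveOn ℝ s v)
    {x₀ : E} (hx₀ : x₀ ∈ s) : ∃ l : StrongDual ℝ E, ∀ x ∈ s, v x ≤ v x₀ + l (x - x₀) := by
  have hcont := hv.continuousOn hs
  have hopen : IsOpen {p : E × ℝ | p.1 ∈ s ∧ p.2 < v p.1} := by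
    rw [isOpen_iff_mem_nhds]
    rintro ⟨x, t⟩ ⟨hx, ht⟩
    have hvx : ContinuousAt (fun p : E × ℝ => v p.1) (x, t) :=
      ContinuousAt.comp (f := Prod.fst) (hcont.continuousAt (hs.mem_nhds hx)) continuousAt_fst
    filter_upwards [continuousAt_fst.preimage_mem_nhds (hs.mem_nhds hx),
      continuousAt_snd.eventually_lt hvx ht] with p h₁ h₂ using ⟨h₁, h₂⟩
  obtain ⟨φ, hφ⟩ := geometric_hahn_banach_open_point hv.convex_strict_hypograph hopen
    (x := (x₀, v x₀)) (fun h => lt_irrefl _ h.2)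
  have hsplit : ∀ x t, φ (x, t) = φ (x, 0) + t * φ (0, 1) := by
    intro x t
    have : ((x, t) : E × ℝ) = (x, 0) + t • ((0, 1) : E × ℝ) := by simp
    rw [this, map_add, map_smul, smul_eq_mul]
  have hb : 0 < φ (0, 1) := by
    have h := hφ (x₀, v x₀ - 1) ⟨hx₀, by simp⟩
    rw [hsplit, hsplit x₀ (v x₀)] at h
    linarith
  refine ⟨-(φ (0, 1))⁻¹ • φ.comp (ContinuousLinearMap.inl ℝ E ℝ), fun x hx => ?_⟩
  have hlim : φ (x, v x) ≤ φ (x₀, v x₀) := by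
    rw [hsplit]
    refine le_of_forall_pos_lt_add fun ε hε => ?_
    have h := hφ (x, v x - ε / φ (0, 1)) ⟨hx, by simpa using div_pos hε hb⟩
    rw [hsplit, sub_mul, div_mul_cancel₀ _ hb.ne'] at h
    linarith
  rw [hsplit, hsplit x₀] at hlim
  have hdiff : φ (x - x₀, 0) = φ (x, 0) - φ (x₀, 0) := by
    rw [← map_sub, Prod.mk_sub_mk, sub_zero]
  have hval : (-(φ (0, 1))⁻¹ • φ.comp (ContinuousLinearMap.inl ℝ E ℝ)) (x - x₀)
      = (φ (x₀, 0) - φ (x, 0)) / φ (0, 1) := by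
    simp only [smul_apply, ContinuousLinearMap.comp_apply,
      ContinuousLinearMap.inl_apply, smul_eq_mul, hdiff]
    ring
  rw [hval, ← sub_le_iff_le_add', le_div_iff₀ hb]
  linarith

/-- The value function is the real supremum where the problem is feasible and bounded. -/
theorem Vfun_eq_coe_sSup {n m q : ℕ}
    {f : EuclideanSpace ℝ (Fin n) → EuclideanSpace ℝ (Fin m) → ℝ}
    {g : EuclideanSpace ℝ (Fin n) → EuclideanSpace ℝ (Fin m) → Fin q → ℝ}
    {x : EuclideanSpace ℝ (Fin n)} (hne : (Feas g x).Nonempty)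
    (hbdd : BddAbove (f x '' Feas g x)) :
    Vfun f g x = ((sSup (f x '' Feas g x) : ℝ) : EReal) := by
  apply le_antisymm
  · refine sSup_le ?_
    rintro _ ⟨y, hy, rfl⟩
    exact EReal.coe_le_coe_iff.2 (le_csSup hbdd ⟨y, hy, rfl⟩)
  · by_contra! h
    obtain ⟨r, hr₁, hr₂⟩ := EReal.lt_iff_exists_real_btwn.1 h
    obtain ⟨_, ⟨y, hy, rfl⟩, hlt⟩ :=
      exists_lt_of_lt_csSup (hne.image _) (EReal.coe_lt_coe_iff.1 hr₂)
    have hle : (f x y : EReal) ≤ Vfun f g x := le_sSup ⟨y, hy, rfl⟩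
    exact absurd (EReal.coe_lt_coe_iff.2 hlt) (hle.trans hr₁.le).not_gt

/-- Partial maximization of a jointly concave function over the sections of a convex set is
concave. -/
theorem concaveOn_sSup_image {E F : Type*} [AddCommGroup E] [Module ℝ E]
    [AddCommGroup F] [Module ℝ F] {f : E → F → ℝ} {C : E → Set F} {s : Set E}
    (hs : Convex ℝ s) (hf : ConcaveOn ℝ {p : E × F | p.2 ∈ C p.1} fun p => f p.1 p.2)
    (hne : ∀ x ∈ s, (C x).Nonempty) (hbdd : ∀ x ∈ s, BddAbove (f x '' C x)) :
    ConcaveOn ℝ s fun x => sSup (f x '' C x) := by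
  refine ⟨hs, fun x hx x' hx' a b ha hb hab => ?_⟩
  have key : ∀ y ∈ C x, ∀ y' ∈ C x',
      a * f x y + b * f x' y' ≤ sSup (f (a • x + b • x') '' C (a • x + b • x')) := by
    intro y hy y' hy'
    refine (hf.2 (x := (x, y)) hy (y := (x', y')) hy' ha hb hab).trans
      (le_csSup (hbdd _ (hs hx hx' ha hb hab)) ⟨a • y + b • y', ?_, rfl⟩)
    exact hf.1 (x := (x, y)) hy (y := (x', y')) hy' ha hb hab
  refine le_of_forall_pos_le_add fun ε hε => ?_
  obtain ⟨_, ⟨y, hy, rfl⟩, h⟩ :=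
    exists_lt_of_lt_csSup ((hne x hx).image (f x)) (sub_lt_self _ hε)
  obtain ⟨_, ⟨y', hy', rfl⟩, h'⟩ :=
    exists_lt_of_lt_csSup ((hne x' hx').image (f x')) (sub_lt_self _ hε)
  have h₁ := mul_le_mul_of_nonneg_left h.le ha
  have h₂ := mul_le_mul_of_nonneg_left h'.le hb
  have h₃ := key y hy y' hy'
  have h₄ : a * ε + b * ε = ε := by rw [← add_mul, hab, one_mul]
  simp only [smul_eq_mul]
  linarith

/-- A regular normal is a limiting normal. -/
theorem regNC_subset_limNC {n : ℕ} {C : Set (EuclideanSpace ℝ (Fin n))}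
    {x₀ : EuclideanSpace ℝ (Fin n)} (hx₀ : x₀ ∈ C) : regNC C x₀ ⊆ limNC C x₀ :=
  fun ξ hξ => ⟨fun _ => x₀, fun _ => ξ, fun _ => hx₀, fun _ => hξ, tendsto_const_nhds,
    tendsto_const_nhds⟩

/-- Theorem 4.7 — optimality condition under joint concavity of `f` and joint
quasiconvexity of `g`. -/
theorem stmt19 {n m q : ℕ}
    (f : EuclideanSpace ℝ (Fin n) → EuclideanSpace ℝ (Fin m) → ℝ)
    (g : EuclideanSpace ℝ (Fin n) → EuclideanSpace ℝ (Fin m) → Fin q → ℝ)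
    (hf : ContDiff ℝ 1 (fun p : EuclideanSpace ℝ (Fin n) × EuclideanSpace ℝ (Fin m) => f p.1 p.2))
    (hg : ∀ i, ContDiff ℝ 1
      (fun p : EuclideanSpace ℝ (Fin n) × EuclideanSpace ℝ (Fin m) => g p.1 p.2 i))
    (X : Set (EuclideanSpace ℝ (Fin n))) (hXc : IsClosed X)
    (xb : EuclideanSpace ℝ (Fin n)) (yb : EuclideanSpace ℝ (Fin m))
    (hstack : StackelbergLocal f g X xb yb)
    (hconc : ConcaveOn ℝ Set.univ
      (fun p : EuclideanSpace ℝ (Fin n) × EuclideanSpace ℝ (Fin m) => f p.1 p.2))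
    (hquasi : ∀ i, QuasiconvexOn ℝ Set.univ
      (fun p : EuclideanSpace ℝ (Fin n) × EuclideanSpace ℝ (Fin m) => g p.1 p.2 i))
    (O : Set (EuclideanSpace ℝ (Fin n))) (hO : IsOpen O) (hxbO : xb ∈ O)
    (hbdd : ∀ x ∈ O, (Feas g x).Nonempty ∧ BddAbove (f x '' Feas g x))
    (hcq : CQAt (fun (w : EuclideanSpace ℝ (Fin n) × EuclideanSpace ℝ (Fin m)) i => g w.1 w.2 i)
      (fun _ : EuclideanSpace ℝ (Fin n) × EuclideanSpace ℝ (Fin m) => (fun _ : Fin 0 => (0 : ℝ)))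
      (xb, yb)) :
    ∃ lamb : Fin q → ℝ,
      -(gradxL f g xb yb lamb) ∈ limNC X xb ∧
      gradyL f g xb yb lamb = 0 ∧ (∀ i, 0 ≤ lamb i) ∧ (∀ i, g xb yb i ≤ 0) ∧
      ∑ i, lamb i * g xb yb i = 0 := by
  obtain ⟨hxbX, ⟨hybF, hybV⟩, hmin⟩ := hstack
  obtain ⟨r, hr, hrO⟩ := Metric.isOpen_iff.1 hO xb hxbO
  have hfeas : Convex ℝ {p : EuclideanSpace ℝ (Fin n) × EuclideanSpace ℝ (Fin m) |
      p.2 ∈ Feas g p.1} := by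
    have h : {p : EuclideanSpace ℝ (Fin n) × EuclideanSpace ℝ (Fin m) | p.2 ∈ Feas g p.1} =
        ⋂ i, {p | p ∈ Set.univ ∧ g p.1 p.2 i ≤ 0} := by
      ext p
      simp [Feas]
    rw [h]
    exact convex_iInter fun i => hquasi i 0
  have hVconc := concaveOn_sSup_image (s := ball xb r) (convex_ball xb r)
    (hconc.subset (Set.subset_univ _) hfeas) (fun x hx => (hbdd x (hrO hx)).1)
    (fun x hx => (hbdd x (hrO hx)).2)
  obtain ⟨l, hl⟩ := hVconc.exists_supergradient isOpen_ball (mem_ball_self hr)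
  have hV : ∀ x ∈ ball xb r, Vfun f g x = ((sSup (f x '' Feas g x) : ℝ) : EReal) :=
    fun x hx => Vfun_eq_coe_sSup (hbdd x (hrO hx)).1 (hbdd x (hrO hx)).2
  have hVb : f xb yb = sSup (f xb '' Feas g xb) := by
    rw [hV xb (mem_ball_self hr)] at hybV
    exact EReal.coe_injective hybV
  have hfd := (hf.differentiable one_ne_zero) (xb, yb)
  have hgd := fun i => ((hg i).differentiable one_ne_zero) (xb, yb)
  obtain ⟨lam, mu, hlam, hkkt, hcomp⟩ := hcq (fun p => l p.1 - f p.1 p.2)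
    ((l.contDiff.comp contDiff_fst).sub hf) (by
      have hball : ∀ᶠ p : EuclideanSpace ℝ (Fin n) × EuclideanSpace ℝ (Fin m)
          in 𝓝 (xb, yb), p.1 ∈ ball xb r :=
        continuousAt_fst.preimage_mem_nhds (ball_mem_nhds xb hr)
      filter_upwards [mem_nhdsWithin_of_mem_nhds hball, self_mem_nhdsWithin] with p hp hpF
      have h₁ : f p.1 p.2 ≤ sSup (f p.1 '' Feas g p.1) :=
        le_csSup (hbdd p.1 (hrO hp)).2 ⟨p.2, hpF.1, rfl⟩
      have h₂ := hl p.1 hp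
      rw [map_sub] at h₂
      linarith)
  have hLag : HasFDerivAt (fun p : EuclideanSpace ℝ (Fin n) × EuclideanSpace ℝ (Fin m) =>
      Lag f g p.1 p.2 lam) (l.comp (ContinuousLinearMap.fst ℝ _ _)) (xb, yb) := by
    have h := hfd.hasFDerivAt.sub
      (HasFDerivAt.fun_sum (u := Finset.univ) fun i _ => (hgd i).hasFDerivAt.const_mul (lam i))
    refine h.congr_fderiv ?_
    have hθ : fderiv ℝ (fun p : EuclideanSpace ℝ (Fin n) × EuclideanSpace ℝ (Fin m) =>
        l p.1 - f p.1 p.2) (xb, yb) = l.comp (ContinuousLinearMap.fst ℝ _ _) -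
          fderiv ℝ (fun p : EuclideanSpace ℝ (Fin n) × EuclideanSpace ℝ (Fin m) =>
            f p.1 p.2) (xb, yb) :=
      ((l.hasFDerivAt.comp (xb, yb) hasFDerivAt_fst).sub hfd.hasFDerivAt).fderiv
    rw [hθ, Finset.univ_eq_empty (α := Fin 0), Finset.sum_empty, add_zero] at hkkt
    rw [← sub_eq_zero, ← neg_eq_zero, ← hkkt]
    abel
  have hgradx : gradxL f g xb yb lam = (InnerProductSpace.toDual ℝ _).symm l := by
    refine HasGradientAt.gradient (hasFDerivAt_iff_hasGradientAt.1 ?_)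
    exact (hLag.comp (f := fun x => (x, yb)) xb (hasFDerivAt_prodMk_left xb yb)).congr_fderiv
      (by ext x; simp)
  have hgrady : gradyL f g xb yb lam = 0 := by
    refine HasGradientAt.gradient ?_
    rw [hasGradientAt_iff_hasFDerivAt, map_zero]
    exact (hLag.comp (f := fun y => (xb, y)) yb (hasFDerivAt_prodMk_right xb yb)).congr_fderiv
      (by ext y; simp)
  refine ⟨lam, regNC_subset_limNC hxbX ?_, hgrady, hlam, hybF, hcomp⟩
  intro ε hε
  obtain ⟨δ, hδ, hδmin⟩ := Metric.mem_nhdsWithin_iff.1 hmin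
  refine ⟨min δ r, lt_min hδ hr, fun x hx hxδ => ?_⟩
  rw [← dist_eq_norm] at hxδ
  have hxr : x ∈ ball xb r := hxδ.trans_le (min_le_right _ _)
  have h₁ : Vfun f g xb ≤ Vfun f g x := hδmin ⟨hxδ.trans_le (min_le_left _ _), hx⟩
  rw [hV x hxr, hV xb (mem_ball_self hr), EReal.coe_le_coe_iff] at h₁
  have h₂ := hl x hxr
  rw [hgradx, inner_neg_left, InnerProductSpace.toDual_symm_apply]
  have h₃ : 0 ≤ ε * ‖x - xb‖ := by positivity
  linarith
end
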